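/- Let N ≥ 4 be a real number, T > 0, j ∈ ℕ, M > 0. Let b₂, b₁, b₀ ∈ C^∞([0,T]×[0,1]) satisfy |b₂ − 1| ≤ 1/2 everywhere and |b⃗|₆^T ≤ M, where b⃗ = (b₂,b₁,b₀). Let τ₂ ∈ (0,T), let G ∈ C^∞([0,T]×[0,1]) vanish for 0 ≤ t ≤ τ₂, and let H ∈ C^∞([0,T]×[0,1]) satisfy ∂_t²H + 𝒜H = G on [0,T]×(0,1), H(t,1) = 0 for all t, and H(t,·) = 0 for 0 ≤ t ≤ τ₂. Then there is a constant C = C(j, M, N, T) such that: sup_{0≤t≤T} ‖∂_t^j H(t,·)‖₁ ≤ C·( ‖G‖_j^T + ‖H‖_{j+1}^T + |b⃗|_{j+4}^T·‖H‖₂^T + |b⃗|_{j+5}^T·‖H‖₁^T ). -/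

import Mathlib

open MeasureTheory Real Set

noncomputable section

/-- The degenerate operator `Δy(z) = z y''(z) + (N/2) y'(z)`. -/
def Del (N : ℝ) (f : ℝ → ℝ) : ℝ → ℝ :=
  fun z => z * deriv (deriv f) z + (N / 2) * deriv f z

/-- Iterates `Δ^m`. -/
def DelIter (N : ℝ) : ℕ → (ℝ → ℝ) → ℝ → ℝ
  | 0 => fun f => f
  | m + 1 => fun f => Del N (DelIter N m f)

/-- `Ḋ = √z d/dz`. -/
def Ddot (f : ℝ → ℝ) : ℝ → ℝ := fun z => Real.sqrt z * deriv f z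

/-- The weighted L² norm on (0,1). -/
def Xnorm (N : ℝ) (f : ℝ → ℝ) : ℝ :=
  Real.sqrt (∫ z in (0:ℝ)..1, (f z) ^ 2 * z ^ (N / 2 - 1))

/-- Graded seminorms `(y)_ℓ`. -/
def gnorm (N : ℝ) (ℓ : ℕ) (f : ℝ → ℝ) : ℝ :=
  if ℓ % 2 = 0 then Xnorm N (DelIter N (ℓ / 2) f)
  else Xnorm N (Ddot (DelIter N (ℓ / 2) f))

/-- Graded norm `‖y‖_n`. -/
def normN (N : ℝ) (n : ℕ) (f : ℝ → ℝ) : ℝ :=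
  Real.sqrt (∑ ℓ ∈ Finset.range (n + 1), (gnorm N ℓ f) ^ 2)

/-- Sup norm on [0,1]. -/
def supN (f : ℝ → ℝ) : ℝ := ⨆ z : Icc (0:ℝ) 1, |f z.1|

/-- `|y|_n = ∑_{ℓ≤n} ‖Ḋ^ℓ y‖_{L^∞(0,1)}`. -/
def supLow (n : ℕ) (f : ℝ → ℝ) : ℝ := ∑ ℓ ∈ Finset.range (n + 1), supN (Ddot^[ℓ] f)

/-- Time derivative of a function of (t,z). -/
def dt (y : ℝ → ℝ → ℝ) : ℝ → ℝ → ℝ := fun t z => deriv (fun s => y s z) t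

/-- Sup norm on [0,T]×[0,1]. -/
def supT (T : ℝ) (y : ℝ → ℝ → ℝ) : ℝ :=
  ⨆ (t : Icc (0:ℝ) T) (z : Icc (0:ℝ) 1), |y t.1 z.1|

/-- `|y|_n^T = sup_{j+k≤n} ‖∂_t^j Ḋ^k y‖_{L^∞([0,T]×[0,1])}`. -/
def supNT (T : ℝ) (n : ℕ) (y : ℝ → ℝ → ℝ) : ℝ :=
  ⨆ p : {p : ℕ × ℕ // p.1 + p.2 ≤ n}, supT T (fun t => Ddot^[p.1.2] (dt^[p.1.1] y t))

/-- `‖y‖_n^T`. -/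
def normT (N T : ℝ) (n : ℕ) (y : ℝ → ℝ → ℝ) : ℝ :=
  Real.sqrt (∑ j ∈ Finset.range (n + 1), ∑ k ∈ Finset.range (n + 1 - j),
    ∫ t in (0:ℝ)..T, (normN N k (dt^[j] y t)) ^ 2)

/-- `Z_n(H)(t) = ∑_{j+k=n} ‖∂_t^j H(t,·)‖_k`. -/
def ZZ (N : ℝ) (n : ℕ) (H : ℝ → ℝ → ℝ) (t : ℝ) : ℝ :=
  ∑ j ∈ Finset.range (n + 1), normN N (n - j) (dt^[j] H t)

/-- The operator `𝒜h = -b₂ Δh + b₁ Ďh + b₀ h` with time-dependent coefficients. -/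
def opA (N : ℝ) (b₂ b₁ b₀ : ℝ → ℝ → ℝ) (H : ℝ → ℝ → ℝ) : ℝ → ℝ → ℝ :=
  fun t z => -(b₂ t z) * Del N (H t) z + b₁ t z * (z * deriv (H t) z) + b₀ t z * H t z

end

/-! ### Smooth calculus in two variables -/

/-- Smoothness of a curried function. -/
def Sm (y : ℝ → ℝ → ℝ) : Prop := ContDiff ℝ (⊤ : ℕ∞) (fun p : ℝ × ℝ => y p.1 p.2)

/-- Continuity of a curried function. -/
def Ct (y : ℝ → ℝ → ℝ) : Prop := Continuous (fun p : ℝ × ℝ => y p.1 p.2)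

/-- Space derivative. -/
noncomputable def dz (y : ℝ → ℝ → ℝ) : ℝ → ℝ → ℝ := fun t z => deriv (y t) z

lemma Sm.ct {y : ℝ → ℝ → ℝ} (h : Sm y) : Ct y := ContDiff.continuous h

lemma Sm.differentiableAt {y : ℝ → ℝ → ℝ} (h : Sm y) (p : ℝ × ℝ) :
    DifferentiableAt ℝ (fun p : ℝ × ℝ => y p.1 p.2) p :=
  (ContDiff.differentiable h (by simp)) p

lemma Sm.hasDerivAt_t' {y : ℝ → ℝ → ℝ} (h : Sm y) (t z : ℝ) :
    HasDerivAt (fun s => y s z) (fderiv ℝ (fun p : ℝ × ℝ => y p.1 p.2) (t, z) (1, 0)) t := by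
  have h1 := (h.differentiableAt (t, z)).hasFDerivAt
  have h2 : HasDerivAt (fun s : ℝ => (s, z)) ((1 : ℝ), (0 : ℝ)) t :=
    (hasDerivAt_id t).prodMk (hasDerivAt_const t z)
  exact HasFDerivAt.comp_hasDerivAt t h1 h2

lemma Sm.hasDerivAt_z' {y : ℝ → ℝ → ℝ} (h : Sm y) (t z : ℝ) :
    HasDerivAt (y t) (fderiv ℝ (fun p : ℝ × ℝ => y p.1 p.2) (t, z) (0, 1)) z := by
  have h1 := (h.differentiableAt (t, z)).hasFDerivAt
  have h2 : HasDerivAt (fun s : ℝ => (t, s)) ((0 : ℝ), (1 : ℝ)) z :=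
    (hasDerivAt_const z t).prodMk (hasDerivAt_id z)
  exact HasFDerivAt.comp_hasDerivAt z h1 h2

lemma Sm.dt_eq {y : ℝ → ℝ → ℝ} (h : Sm y) :
    dt y = fun t z => fderiv ℝ (fun p : ℝ × ℝ => y p.1 p.2) (t, z) (1, 0) := by
  funext t z; exact (h.hasDerivAt_t' t z).deriv

lemma Sm.dz_eq {y : ℝ → ℝ → ℝ} (h : Sm y) :
    dz y = fun t z => fderiv ℝ (fun p : ℝ × ℝ => y p.1 p.2) (t, z) (0, 1) := by
  funext t z; exact (h.hasDerivAt_z' t z).deriv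

lemma Sm.fd {y : ℝ → ℝ → ℝ} (h : Sm y) :
    ContDiff ℝ (⊤ : ℕ∞) (fderiv ℝ (fun p : ℝ × ℝ => y p.1 p.2)) :=
  ContDiff.fderiv_right h (by simp)

lemma Sm.dt {y : ℝ → ℝ → ℝ} (h : Sm y) : Sm (dt y) := by
  rw [h.dt_eq]
  exact h.fd.clm_apply contDiff_const

lemma Sm.dz {y : ℝ → ℝ → ℝ} (h : Sm y) : Sm (dz y) := by
  rw [h.dz_eq]
  exact h.fd.clm_apply contDiff_const

lemma Sm.dt_iter {y : ℝ → ℝ → ℝ} (h : Sm y) (k : ℕ) : Sm (_root_.dt^[k] y) := by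
  induction k generalizing y with
  | zero => exact h
  | succ k ih => rw [Function.iterate_succ_apply]; exact ih h.dt

lemma Sm.hasDerivAt_t {y : ℝ → ℝ → ℝ} (h : Sm y) (t z : ℝ) :
    HasDerivAt (fun s => y s z) (_root_.dt y t z) t := by
  rw [h.dt_eq]; exact h.hasDerivAt_t' t z

lemma Sm.hasDerivAt_z {y : ℝ → ℝ → ℝ} (h : Sm y) (t z : ℝ) :
    HasDerivAt (y t) (_root_.dz y t z) z := by
  rw [h.dz_eq]; exact h.hasDerivAt_z' t z

lemma Sm.dt_dz {y : ℝ → ℝ → ℝ} (h : Sm y) : _root_.dt (_root_.dz y) = _root_.dz (_root_.dt y) := by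
  funext t z
  set Y := (fun p : ℝ × ℝ => y p.1 p.2) with hY
  have hsym : IsSymmSndFDerivAt ℝ Y (t, z) :=
    (ContDiff.contDiffAt h).isSymmSndFDerivAt
      (by simp only [minSmoothness_of_isRCLikeNormedField]; exact WithTop.coe_le_coe.2 (le_top : (2:ℕ∞) ≤ ⊤))
  have hd : DifferentiableAt ℝ (fderiv ℝ Y) (t, z) := (h.fd.differentiable (by simp)) (t, z)
  have e1 : HasDerivAt (fun s => _root_.dz y s z) (fderiv ℝ (fderiv ℝ Y) (t, z) (1, 0) (0, 1)) t := by
    rw [h.dz_eq]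
    have h2 : HasDerivAt (fun s : ℝ => (s, z)) ((1 : ℝ), (0 : ℝ)) t :=
      (hasDerivAt_id t).prodMk (hasDerivAt_const t z)
    have h3 := HasFDerivAt.comp_hasDerivAt t hd.hasFDerivAt h2
    exact h3.clm_apply (hasDerivAt_const t ((0 : ℝ), (1 : ℝ))) |>.congr_deriv (by simp)
  have e2 : HasDerivAt (fun s => _root_.dt y t s) (fderiv ℝ (fderiv ℝ Y) (t, z) (0, 1) (1, 0)) z := by
    rw [h.dt_eq]
    have h2 : HasDerivAt (fun s : ℝ => (t, s)) ((0 : ℝ), (1 : ℝ)) z :=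
      (hasDerivAt_const z t).prodMk (hasDerivAt_id z)
    have h3 := HasFDerivAt.comp_hasDerivAt z hd.hasFDerivAt h2
    exact h3.clm_apply (hasDerivAt_const z ((1 : ℝ), (0 : ℝ))) |>.congr_deriv (by simp)
  have := hsym.eq (1, 0) (0, 1)
  show deriv _ t = deriv _ z
  rw [e1.deriv, e2.deriv, this]

lemma Sm.add {f g : ℝ → ℝ → ℝ} (hf : Sm f) (hg : Sm g) : Sm (fun t z => f t z + g t z) :=
  ContDiff.add hf hg
lemma Sm.sub {f g : ℝ → ℝ → ℝ} (hf : Sm f) (hg : Sm g) : Sm (fun t z => f t z - g t z) :=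
  ContDiff.sub hf hg
lemma Sm.mul {f g : ℝ → ℝ → ℝ} (hf : Sm f) (hg : Sm g) : Sm (fun t z => f t z * g t z) :=
  ContDiff.mul hf hg
lemma Sm.const (c : ℝ) : Sm (fun _ _ => c) := contDiff_const
lemma Sm.snd : Sm (fun _ z => z) := contDiff_snd

lemma Ct.add {f g : ℝ → ℝ → ℝ} (hf : Ct f) (hg : Ct g) : Ct (fun t z => f t z + g t z) :=
  Continuous.add hf hg
lemma Ct.sub {f g : ℝ → ℝ → ℝ} (hf : Ct f) (hg : Ct g) : Ct (fun t z => f t z - g t z) :=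
  Continuous.sub hf hg
lemma Ct.mul {f g : ℝ → ℝ → ℝ} (hf : Ct f) (hg : Ct g) : Ct (fun t z => f t z * g t z) :=
  Continuous.mul hf hg
lemma Ct.sq {f : ℝ → ℝ → ℝ} (hf : Ct f) : Ct (fun t z => (f t z) ^ 2) :=
  Continuous.pow hf 2
lemma Ct.const (c : ℝ) : Ct (fun _ _ => c) := continuous_const
lemma Ct.snd : Ct (fun _ z => z) := continuous_snd
lemma Ct.ofz {g : ℝ → ℝ} (hg : Continuous g) : Ct (fun _ z => g z) := hg.comp continuous_snd
lemma Ct.slice {f : ℝ → ℝ → ℝ} (hf : Ct f) (t : ℝ) : Continuous (f t) :=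
  Continuous.comp (g := fun p : ℝ × ℝ => f p.1 p.2) hf (Continuous.prodMk continuous_const continuous_id)
lemma Ct.slice_t {f : ℝ → ℝ → ℝ} (hf : Ct f) (z : ℝ) : Continuous (fun t => f t z) :=
  Continuous.comp (g := fun p : ℝ × ℝ => f p.1 p.2) hf (Continuous.prodMk continuous_id continuous_const)

lemma dt_iter_eq (y : ℝ → ℝ → ℝ) (k : ℕ) (t z : ℝ) :
    dt^[k] y t z = iteratedDeriv k (fun s => y s z) t := by
  rw [iteratedDeriv_eq_iterate]
  induction k generalizing y with
  | zero => rfl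
  | succ k ih => rw [Function.iterate_succ_apply, Function.iterate_succ_apply, ih]; rfl

lemma Sm.slice_t {y : ℝ → ℝ → ℝ} (h : Sm y) (z : ℝ) :
    ContDiff ℝ (⊤ : ℕ∞) (fun s => y s z) :=
  ContDiff.comp (g := fun p : ℝ × ℝ => y p.1 p.2) h (contDiff_id.prodMk contDiff_const)

lemma dt_congr {f g : ℝ → ℝ → ℝ} (hf : Sm f) (hg : Sm g) {a b : ℝ} (hab : a < b) {z : ℝ}
    (h : ∀ t ∈ Icc a b, f t z = g t z) : ∀ t ∈ Icc a b, dt f t z = dt g t z := by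
  intro t ht
  have hu := uniqueDiffOn_Icc hab t ht
  have h1 := (hf.hasDerivAt_t t z).hasDerivWithinAt (s := Icc a b)
  have h2 := (hg.hasDerivAt_t t z).hasDerivWithinAt (s := Icc a b)
  have h3 := h1.congr (fun x hx => (h x hx).symm) (h t ht).symm
  exact hu.eq_deriv _ h3 h2

lemma dt_iter_congr {f g : ℝ → ℝ → ℝ} (hf : Sm f) (hg : Sm g) {a b : ℝ} (hab : a < b) {z : ℝ}
    (h : ∀ t ∈ Icc a b, f t z = g t z) (k : ℕ) :
    ∀ t ∈ Icc a b, dt^[k] f t z = dt^[k] g t z := by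
  induction k generalizing f g with
  | zero => exact h
  | succ k ih =>
    simp only [Function.iterate_succ_apply]
    exact ih hf.dt hg.dt (dt_congr hf hg hab h)

lemma dt_const (c : ℝ) : dt (fun _ _ => c) = fun _ _ => 0 := by
  funext t z; simp [dt]

lemma dt_iter_zero (k : ℕ) : dt^[k] (fun _ _ => (0:ℝ)) = fun _ _ => 0 := by
  induction k with
  | zero => rfl
  | succ k ih => rw [Function.iterate_succ_apply, dt_const, ih]

lemma dt_iter_vanish {f : ℝ → ℝ → ℝ} (hf : Sm f) {a b : ℝ} (hab : a < b) {z : ℝ}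
    (h : ∀ t ∈ Icc a b, f t z = 0) (k : ℕ) :
    ∀ t ∈ Icc a b, dt^[k] f t z = 0 := by
  intro t ht
  have := dt_iter_congr hf (Sm.const 0) hab h k t ht
  rw [this, dt_iter_zero]

lemma dt_add {f g : ℝ → ℝ → ℝ} (hf : Sm f) (hg : Sm g) :
    dt (fun t z => f t z + g t z) = fun t z => dt f t z + dt g t z := by
  funext t z; exact ((hf.hasDerivAt_t t z).add (hg.hasDerivAt_t t z)).deriv

lemma dt_sub {f g : ℝ → ℝ → ℝ} (hf : Sm f) (hg : Sm g) :
    dt (fun t z => f t z - g t z) = fun t z => dt f t z - dt g t z := by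
  funext t z; exact ((hf.hasDerivAt_t t z).sub (hg.hasDerivAt_t t z)).deriv

lemma dt_mul {f g : ℝ → ℝ → ℝ} (hf : Sm f) (hg : Sm g) :
    dt (fun t z => f t z * g t z) = fun t z => dt f t z * g t z + f t z * dt g t z := by
  funext t z; exact ((hf.hasDerivAt_t t z).mul (hg.hasDerivAt_t t z)).deriv

lemma dt_zmul {g : ℝ → ℝ → ℝ} (c : ℝ → ℝ) (hg : Sm g) :
    dt (fun t z => c z * g t z) = fun t z => c z * dt g t z := by
  funext t z; exact ((hg.hasDerivAt_t t z).const_mul (c z)).deriv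

lemma dt_iter_add {f g : ℝ → ℝ → ℝ} (hf : Sm f) (hg : Sm g) (k : ℕ) :
    dt^[k] (fun t z => f t z + g t z) = fun t z => dt^[k] f t z + dt^[k] g t z := by
  induction k generalizing f g with
  | zero => rfl
  | succ k ih => simp only [Function.iterate_succ_apply]; rw [dt_add hf hg, ih hf.dt hg.dt]

lemma dt_iter_sub {f g : ℝ → ℝ → ℝ} (hf : Sm f) (hg : Sm g) (k : ℕ) :
    dt^[k] (fun t z => f t z - g t z) = fun t z => dt^[k] f t z - dt^[k] g t z := by
  induction k generalizing f g with
  | zero => rfl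
  | succ k ih => simp only [Function.iterate_succ_apply]; rw [dt_sub hf hg, ih hf.dt hg.dt]

lemma dt_iter_dz {y : ℝ → ℝ → ℝ} (hy : Sm y) (k : ℕ) :
    dt^[k] (dz y) = dz (dt^[k] y) := by
  induction k generalizing y with
  | zero => rfl
  | succ k ih => simp only [Function.iterate_succ_apply]; rw [hy.dt_dz, ih hy.dt]

lemma dt_iter_zmul {g : ℝ → ℝ → ℝ} (c : ℝ → ℝ) (hg : Sm g) (k : ℕ) :
    dt^[k] (fun t z => c z * g t z) = fun t z => c z * dt^[k] g t z := by
  induction k generalizing g with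
  | zero => rfl
  | succ k ih => simp only [Function.iterate_succ_apply]; rw [dt_zmul c hg, ih hg.dt]

/-- The operator `Δ` on curried functions. -/
noncomputable def Lap (N : ℝ) (y : ℝ → ℝ → ℝ) : ℝ → ℝ → ℝ := fun t z => Del N (y t) z

/-- The operator `z d/dz` on curried functions. -/
noncomputable def DD (y : ℝ → ℝ → ℝ) : ℝ → ℝ → ℝ := fun t z => z * dz y t z

lemma Lap_eq (N : ℝ) (y : ℝ → ℝ → ℝ) :
    Lap N y = fun t z => z * dz (dz y) t z + (N / 2) * dz y t z := rfl

lemma Sm.lap {y : ℝ → ℝ → ℝ} (h : Sm y) (N : ℝ) : Sm (Lap N y) := by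
  rw [Lap_eq]
  exact (Sm.snd.mul h.dz.dz).add ((Sm.const _).mul h.dz)

lemma Sm.DD {y : ℝ → ℝ → ℝ} (h : Sm y) : Sm (DD y) := Sm.snd.mul h.dz

lemma dt_iter_DD {y : ℝ → ℝ → ℝ} (hy : Sm y) (k : ℕ) :
    dt^[k] (DD y) = DD (dt^[k] y) := by
  have := dt_iter_zmul (fun z => z) hy.dz k
  rw [dt_iter_dz hy k] at this
  exact this

lemma dt_iter_lap (N : ℝ) {y : ℝ → ℝ → ℝ} (hy : Sm y) (k : ℕ) :
    dt^[k] (Lap N y) = Lap N (dt^[k] y) := by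
  have h1 := dt_iter_zmul (fun z => z) hy.dz.dz k
  have h2 := dt_iter_zmul (fun _ => N / 2) hy.dz k
  rw [Lap_eq, dt_iter_add (Sm.snd.mul hy.dz.dz) ((Sm.const (N/2)).mul hy.dz) k, h1, h2,
    dt_iter_dz hy.dz, dt_iter_dz hy, Lap_eq]

lemma dt_iter_mul {f g : ℝ → ℝ → ℝ} (hf : Sm f) (hg : Sm g) (k : ℕ) (t z : ℝ) :
    dt^[k] (fun t z => f t z * g t z) t z =
      ∑ i ∈ Finset.range (k + 1), (k.choose i : ℝ) * dt^[i] f t z * dt^[k - i] g t z := by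
  simp only [dt_iter_eq]
  exact iteratedDeriv_fun_mul (((hf.slice_t z).of_le (by exact_mod_cast le_top)).contDiffAt)
    (((hg.slice_t z).of_le (by exact_mod_cast le_top)).contDiffAt)

/-! ### Integrals over the rectangle -/

/-- Integral over `[0,T] × [0,1]`. -/
noncomputable def II (T : ℝ) (f : ℝ → ℝ → ℝ) : ℝ := ∫ t in (0:ℝ)..T, ∫ z in (0:ℝ)..1, f t z

/-- The weight. -/
noncomputable def W (N : ℝ) (z : ℝ) : ℝ := z ^ (N / 2 - 1)

lemma W_cont {N : ℝ} (hN : 4 ≤ N) : Continuous (W N) :=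
  Real.continuous_rpow_const (by linarith)

lemma W_nonneg (N : ℝ) {z : ℝ} (hz : z ∈ Icc (0:ℝ) 1) : 0 ≤ W N z := Real.rpow_nonneg hz.1 _

lemma Ct.W {N : ℝ} (hN : 4 ≤ N) : Ct (fun _ z => W N z) := Ct.ofz (W_cont hN)

lemma Ct.inner {f : ℝ → ℝ → ℝ} (hf : Ct f) : Continuous (fun t => ∫ z in (0:ℝ)..1, f t z) :=
  intervalIntegral.continuous_parametric_intervalIntegral_of_continuous' hf 0 1

lemma II_add {f g : ℝ → ℝ → ℝ} (hf : Ct f) (hg : Ct g) (T : ℝ) :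
    II T (fun t z => f t z + g t z) = II T f + II T g := by
  unfold II
  rw [← intervalIntegral.integral_add (hf.inner.intervalIntegrable _ _)
    (hg.inner.intervalIntegrable _ _)]
  congr 1; funext t
  exact intervalIntegral.integral_add ((hf.slice t).intervalIntegrable _ _)
    ((hg.slice t).intervalIntegrable _ _)

lemma II_smul (c : ℝ) (f : ℝ → ℝ → ℝ) (T : ℝ) :
    II T (fun t z => c * f t z) = c * II T f := by
  unfold II
  simp only [intervalIntegral.integral_const_mul]

lemma II_mono {f g : ℝ → ℝ → ℝ} (hf : Ct f) (hg : Ct g) {T : ℝ} (hT : 0 ≤ T)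
    (h : ∀ t ∈ Icc (0:ℝ) T, ∀ z ∈ Icc (0:ℝ) 1, f t z ≤ g t z) : II T f ≤ II T g := by
  unfold II
  refine intervalIntegral.integral_mono_on hT (hf.inner.intervalIntegrable _ _)
    (hg.inner.intervalIntegrable _ _) fun t ht => ?_
  exact intervalIntegral.integral_mono_on zero_le_one ((hf.slice t).intervalIntegrable _ _)
    ((hg.slice t).intervalIntegrable _ _) (h t ht)

lemma II_nonneg {f : ℝ → ℝ → ℝ} {T : ℝ} (hT : 0 ≤ T)
    (h : ∀ t ∈ Icc (0:ℝ) T, ∀ z ∈ Icc (0:ℝ) 1, 0 ≤ f t z) : 0 ≤ II T f := by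
  unfold II
  refine intervalIntegral.integral_nonneg hT fun t ht => ?_
  exact intervalIntegral.integral_nonneg zero_le_one (h t ht)

lemma II_mono_T {f : ℝ → ℝ → ℝ} (hf : Ct f) {s T : ℝ} (hs : s ∈ Icc (0:ℝ) T)
    (h : ∀ t ∈ Icc (0:ℝ) T, ∀ z ∈ Icc (0:ℝ) 1, 0 ≤ f t z) : II s f ≤ II T f := by
  unfold II
  refine intervalIntegral.integral_mono_interval le_rfl hs.1 hs.2 ?_
    (hf.inner.intervalIntegrable _ _)
  refine (ae_restrict_iff' measurableSet_Ioc).2 (Filter.Eventually.of_forall fun t ht => ?_)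
  exact intervalIntegral.integral_nonneg zero_le_one (h t ⟨ht.1.le, ht.2⟩)

/-- Fundamental theorem in time, integrated in space. -/
lemma II_dt {N : ℝ} (hN : 4 ≤ N) {f : ℝ → ℝ → ℝ} (hf : Sm f) (T : ℝ) (h0 : ∀ z ∈ Icc (0:ℝ) 1, f 0 z = 0) :
    II T (fun t z => dt f t z * W N z) = ∫ z in (0:ℝ)..1, f T z * W N z := by
  unfold II
  have hc : Ct (fun t z => dt f t z * W N z) := hf.dt.ct.mul (Ct.W hN)
  rw [MeasureTheory.intervalIntegral_intervalIntegral_swap]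
  · refine intervalIntegral.integral_congr fun z hz => ?_
    rw [uIcc_of_le zero_le_one] at hz
    have := intervalIntegral.integral_eq_sub_of_hasDerivAt (a := 0) (b := T)
      (f := fun t => f t z * W N z) (f' := fun t => dt f t z * W N z)
      (fun t _ => (hf.hasDerivAt_t t z).mul_const _)
      ((hc.slice_t z).intervalIntegrable _ _)
    simp only [this, h0 z hz]; ring
  · have : Continuous (Function.uncurry (fun t z => dt f t z * W N z)) := hc
    exact (ContinuousOn.integrableOn_compact ((isCompact_uIcc (a := (0:ℝ)) (b := T)).prod
      (isCompact_uIcc (a := (0:ℝ)) (b := 1))) this.continuousOn).mono_set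
      (prod_mono uIoc_subset_uIcc uIoc_subset_uIcc)

/-- Squared weighted space-time norm. -/
noncomputable def QQ (N T : ℝ) (u : ℝ → ℝ → ℝ) : ℝ := II T (fun t z => (u t z) ^ 2 * W N z)

lemma QQ_nonneg (N : ℝ) {T : ℝ} (hT : 0 ≤ T) (u : ℝ → ℝ → ℝ) : 0 ≤ QQ N T u :=
  II_nonneg hT fun _ _ _ hz => mul_nonneg (sq_nonneg _) (W_nonneg N hz)

lemma QQ_mono {N : ℝ} (hN : 4 ≤ N) {T : ℝ} (hT : 0 ≤ T) {u v : ℝ → ℝ → ℝ} (hu : Ct u) (hv : Ct v)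
    (h : ∀ t ∈ Icc (0:ℝ) T, ∀ z ∈ Icc (0:ℝ) 1, (u t z) ^ 2 ≤ (v t z) ^ 2) :
    QQ N T u ≤ QQ N T v :=
  II_mono (hu.sq.mul (Ct.W hN)) (hv.sq.mul (Ct.W hN)) hT fun t ht z hz =>
    mul_le_mul_of_nonneg_right (h t ht z hz) (W_nonneg N hz)

lemma QQ_bdd_mul {N : ℝ} (hN : 4 ≤ N) {T : ℝ} (hT : 0 ≤ T) {b u : ℝ → ℝ → ℝ} (hb : Ct b) (hu : Ct u)
    {B : ℝ} (h : ∀ t ∈ Icc (0:ℝ) T, ∀ z ∈ Icc (0:ℝ) 1, |b t z| ≤ B) :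
    QQ N T (fun t z => b t z * u t z) ≤ B ^ 2 * QQ N T u := by
  unfold QQ
  rw [← II_smul]
  refine II_mono ((hb.mul hu).sq.mul (Ct.W hN)) ((Ct.const _).mul (hu.sq.mul (Ct.W hN))) hT
    fun t ht z hz => ?_
  rw [← mul_assoc]
  refine mul_le_mul_of_nonneg_right ?_ (W_nonneg N hz)
  rw [mul_pow]
  refine mul_le_mul_of_nonneg_right ?_ (sq_nonneg _)
  rw [← sq_abs]
  exact pow_le_pow_left₀ (abs_nonneg _) (h t ht z hz) 2

lemma Ct.sum {ι : Type*} (s : Finset ι) {f : ι → ℝ → ℝ → ℝ} (hf : ∀ i ∈ s, Ct (f i)) :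
    Ct (fun t z => ∑ i ∈ s, f i t z) :=
  continuous_finsetSum s fun i hi => hf i hi

lemma II_sum {ι : Type*} (s : Finset ι) {f : ι → ℝ → ℝ → ℝ} (hf : ∀ i ∈ s, Ct (f i)) (T : ℝ) :
    II T (fun t z => ∑ i ∈ s, f i t z) = ∑ i ∈ s, II T (f i) := by
  classical
  induction s using Finset.induction_on with
  | empty => simp [II]
  | insert a s ha ih =>
    simp only [Finset.sum_insert ha]
    rw [II_add (hf a (by simp)) (Ct.sum s fun i hi => hf i (by simp [hi])),
      ih fun i hi => hf i (by simp [hi])]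

lemma QQ_sum {ι : Type*} {N : ℝ} (hN : 4 ≤ N) {T : ℝ} (hT : 0 ≤ T) (s : Finset ι)
    {u : ι → ℝ → ℝ → ℝ} (hu : ∀ i ∈ s, Ct (u i)) :
    QQ N T (fun t z => ∑ i ∈ s, u i t z) ≤ s.card * ∑ i ∈ s, QQ N T (u i) := by
  unfold QQ
  rw [← II_sum s (fun i hi => (hu i hi).sq.mul (Ct.W hN)), ← II_smul]
  refine II_mono ((Ct.sum s hu).sq.mul (Ct.W hN))
    ((Ct.const _).mul (Ct.sum s fun i hi => (hu i hi).sq.mul (Ct.W hN))) hT fun t ht z hz => ?_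
  rw [← Finset.sum_mul, ← mul_assoc]
  exact mul_le_mul_of_nonneg_right sq_sum_le_card_mul_sum_sq (W_nonneg N hz)

lemma QQ_smul {N T : ℝ} (c : ℝ) (u : ℝ → ℝ → ℝ) :
    QQ N T (fun t z => c * u t z) = c ^ 2 * QQ N T u := by
  unfold QQ
  rw [← II_smul]; congr 1; funext t z; ring

/-! ### Interpolation in time for the space-time norms -/

lemma interp_eps {N : ℝ} (hN : 4 ≤ N) {T : ℝ} (hT : 0 ≤ T) {u : ℝ → ℝ → ℝ} (hu : Sm u)
    (h0 : ∀ z, u 0 z = 0) (h1 : ∀ z, dt u 0 z = 0) {ε : ℝ} (hε : 0 < ε) :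
    QQ N T (dt u) ≤ 3 * (QQ N T u / ε ^ 2 + ε ^ 2 * QQ N T (dt (dt u))) := by
  set F : ℝ → ℝ → ℝ := fun t z =>
    ((1 / (2 * ε)) * (u t z * u t z) + (ε / 2) * (dt u t z * dt u t z)) - u t z * dt u t z with hF
  have s1 := hu.mul hu
  have s2 := hu.dt.mul hu.dt
  have s3 := hu.mul hu.dt
  have c1 := (Sm.const (1 / (2 * ε))).mul s1
  have c2 := (Sm.const (ε / 2)).mul s2
  have hFs : Sm F := (c1.add c2).sub s3
  have hdF : dt F = fun t z => (1 / ε) * (u t z * dt u t z) + ε * (dt u t z * dt (dt u) t z)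
      - dt u t z ^ 2 - u t z * dt (dt u) t z := by
    rw [hF, dt_sub (c1.add c2) s3, dt_add c1 c2, dt_zmul (fun _ => 1 / (2 * ε)) s1,
      dt_zmul (fun _ => ε / 2) s2, dt_mul hu hu, dt_mul hu.dt hu.dt, dt_mul hu hu.dt]
    funext t z; field_simp; ring
  have hI := II_dt hN hFs T (fun z _ => by simp [hF, h0, h1])
  have hpos : 0 ≤ ∫ z in (0:ℝ)..1, F T z * W N z := by
    refine intervalIntegral.integral_nonneg zero_le_one fun z hz => ?_
    refine mul_nonneg ?_ (W_nonneg N hz)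
    have : F T z = (u T z - ε * dt u T z) ^ 2 / (2 * ε) := by
      simp only [hF]; field_simp; ring
    rw [this]; positivity
  rw [← hI] at hpos
  have hub : II T (fun t z => dt F t z * W N z) ≤
      II T (fun t z => ((-1/2) * (dt u t z ^ 2 * W N z) + (3 / (2 * ε ^ 2)) * (u t z ^ 2 * W N z)) +
        (3 * ε ^ 2 / 2) * (dt (dt u) t z ^ 2 * W N z)) := by
    refine II_mono (hFs.dt.ct.mul (Ct.W hN)) ?_ hT fun t ht z hz => ?_
    · exact (((Ct.const _).mul (hu.dt.ct.sq.mul (Ct.W hN))).add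
        ((Ct.const _).mul (hu.ct.sq.mul (Ct.W hN)))).add
        ((Ct.const _).mul (hu.dt.dt.ct.sq.mul (Ct.W hN)))
    · have hw := W_nonneg N hz
      have key : dt F t z ≤ (-1/2) * dt u t z ^ 2 + (3 / (2 * ε ^ 2)) * u t z ^ 2 +
          (3 * ε ^ 2 / 2) * dt (dt u) t z ^ 2 := by
        rw [hdF]
        set a := u t z
        set b := dt u t z
        set c := dt (dt u) t z
        have e : (-1/2) * b ^ 2 + (3 / (2 * ε ^ 2)) * a ^ 2 + (3 * ε ^ 2 / 2) * c ^ 2 -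
          ((1 / ε) * (a * b) + ε * (b * c) - b ^ 2 - a * c) =
          (a / ε - b / 2) ^ 2 + (ε * c - b / 2) ^ 2 + (a / ε + ε * c) ^ 2 / 2 := by
          field_simp; ring
        have : 0 ≤ (a / ε - b / 2) ^ 2 + (ε * c - b / 2) ^ 2 + (a / ε + ε * c) ^ 2 / 2 := by
          positivity
        linarith
      have := mul_le_mul_of_nonneg_right key hw
      linarith
  rw [II_add, II_add, II_smul, II_smul, II_smul] at hub
  · have h := hpos.trans hub
    change 0 ≤ (-1/2) * QQ N T (dt u) + (3 / (2 * ε ^ 2)) * QQ N T u +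
      (3 * ε ^ 2 / 2) * QQ N T (dt (dt u)) at h
    have e : 3 * (QQ N T u / ε ^ 2 + ε ^ 2 * QQ N T (dt (dt u))) =
      2 * ((3 / (2 * ε ^ 2)) * QQ N T u + (3 * ε ^ 2 / 2) * QQ N T (dt (dt u))) := by
      field_simp
    rw [e]; linarith
  · exact (Ct.const _).mul (hu.dt.ct.sq.mul (Ct.W hN))
  · exact (Ct.const _).mul (hu.ct.sq.mul (Ct.W hN))
  · exact ((Ct.const _).mul (hu.dt.ct.sq.mul (Ct.W hN))).add
        ((Ct.const _).mul (hu.ct.sq.mul (Ct.W hN)))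
  · exact (Ct.const _).mul (hu.dt.dt.ct.sq.mul (Ct.W hN))

/-- Optimizing the `ε` in an interpolation inequality with `ε ∈ (0,1]`. -/
lemma opt_eps {x a d K : ℝ} (hx : 0 ≤ x) (ha : 0 ≤ a) (had : a ≤ d) (hK : 0 ≤ K)
    (h : ∀ ε : ℝ, 0 < ε → ε ≤ 1 → x ≤ K * (a / ε + ε * d)) : x ^ 2 ≤ 4 * K ^ 2 * (a * d) := by
  rcases ha.eq_or_lt with ha0 | ha0
  · subst ha0
    have hx0 : x ≤ 0 := by
      by_contra hc
      push Not at hc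
      have hKd : 0 ≤ K * d := mul_nonneg hK had
      have h1 := h (min 1 (x / (2 * (K * d + 1)))) (by positivity) (min_le_left _ _)
      have h2 : min 1 (x / (2 * (K * d + 1))) ≤ x / (2 * (K * d + 1)) := min_le_right _ _
      have h3 : K * (0 / min 1 (x / (2 * (K * d + 1))) + min 1 (x / (2 * (K * d + 1))) * d)
        = (K * d) * min 1 (x / (2 * (K * d + 1))) := by rw [zero_div]; ring
      rw [h3] at h1
      have h4 := h1.trans (mul_le_mul_of_nonneg_left h2 hKd)
      rw [← mul_div_assoc, le_div_iff₀ (by positivity)] at h4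
      nlinarith
    have : x = 0 := le_antisymm hx0 hx
    simp [this]
  · have hd : 0 < d := ha0.trans_le had
    have sa := Real.sq_sqrt ha
    have sd := Real.sq_sqrt hd.le
    have pa := Real.sqrt_pos.2 ha0
    have pd := Real.sqrt_pos.2 hd
    have h1 := h (√a / √d) (by positivity)
      ((div_le_one pd).2 (Real.sqrt_le_sqrt had))
    have e : K * (a / (√a / √d) + √a / √d * d) = 2 * K * (√a * √d) := by
      field_simp
      rw [sa, sd]; ring
    rw [e] at h1
    calc x ^ 2 ≤ (2 * K * (√a * √d)) ^ 2 := pow_le_pow_left₀ hx h1 2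
      _ = 4 * K ^ 2 * (√a ^ 2 * √d ^ 2) := by ring
      _ = _ := by rw [sa, sd]

/-- Optimizing the `ε` in an interpolation inequality with `ε ∈ (0,∞)`. -/
lemma opt_eps' {x a d K : ℝ} (hx : 0 ≤ x) (ha : 0 ≤ a) (hd : 0 ≤ d) (hK : 0 ≤ K)
    (h : ∀ ε : ℝ, 0 < ε → x ≤ K * (a / ε + ε * d)) : x ^ 2 ≤ 4 * K ^ 2 * (a * d) := by
  rcases le_total a d with had | had
  · exact opt_eps hx ha had hK fun ε h1 _ => h ε h1
  · rw [mul_comm a d]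
    refine opt_eps hx hd had hK fun ε h1 _ => ?_
    have := h (1 / ε) (by positivity)
    convert this using 2
    field_simp
    ring

lemma interp_QQ {N : ℝ} (hN : 4 ≤ N) {T : ℝ} (hT : 0 ≤ T) {u : ℝ → ℝ → ℝ} (hu : Sm u)
    (h0 : ∀ z, u 0 z = 0) (h1 : ∀ z, dt u 0 z = 0) :
    QQ N T (dt u) ^ 2 ≤ 36 * (QQ N T u * QQ N T (dt (dt u))) := by
  have := opt_eps' (K := 3) (QQ_nonneg N hT (dt u)) (QQ_nonneg N hT u)
    (QQ_nonneg N hT (dt (dt u))) (by norm_num) fun ε hε => by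
      have := interp_eps hN hT hu h0 h1 (ε := √ε) (Real.sqrt_pos.2 hε)
      rwa [Real.sq_sqrt hε.le] at this
  linarith

/-! ### Sup norms -/

lemma supT_nonneg (T : ℝ) (u : ℝ → ℝ → ℝ) : 0 ≤ supT T u :=
  Real.iSup_nonneg fun _ => Real.iSup_nonneg fun _ => abs_nonneg _

lemma le_supT {u : ℝ → ℝ → ℝ} (hu : Ct u) {T t z : ℝ} (ht : t ∈ Icc (0:ℝ) T)
    (hz : z ∈ Icc (0:ℝ) 1) : |u t z| ≤ supT T u := by
  obtain ⟨C, hC⟩ := (isCompact_Icc.prod isCompact_Icc :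
    IsCompact (Icc (0:ℝ) T ×ˢ Icc (0:ℝ) 1)).exists_bound_of_continuousOn
      (f := fun p : ℝ × ℝ => u p.1 p.2) (Continuous.continuousOn hu)
  have hC' : ∀ t ∈ Icc (0:ℝ) T, ∀ z ∈ Icc (0:ℝ) 1, |u t z| ≤ C := fun t ht z hz =>
    hC (t, z) ⟨ht, hz⟩
  have : Nonempty (Icc (0:ℝ) 1) := ⟨⟨z, hz⟩⟩
  have h1 : |u t z| ≤ ⨆ z : Icc (0:ℝ) 1, |u t z.1| :=
    le_ciSup (f := fun z : Icc (0:ℝ) 1 => |u t z.1|)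
      ⟨C, by rintro _ ⟨z, rfl⟩; exact hC' t ht z.1 z.2⟩ ⟨z, hz⟩
  refine h1.trans ?_
  exact le_ciSup (f := fun t : Icc (0:ℝ) T => ⨆ z : Icc (0:ℝ) 1, |u t.1 z.1|)
      ⟨C, by rintro _ ⟨t, rfl⟩; exact ciSup_le fun z => hC' t.1 t.2 z.1 z.2⟩ ⟨t, ht⟩

lemma supT_le {u : ℝ → ℝ → ℝ} {T C : ℝ} (hT : 0 ≤ T)
    (h : ∀ t ∈ Icc (0:ℝ) T, ∀ z ∈ Icc (0:ℝ) 1, |u t z| ≤ C) : supT T u ≤ C := by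
  have : Nonempty (Icc (0:ℝ) 1) := ⟨⟨0, by simp⟩⟩
  have : Nonempty (Icc (0:ℝ) T) := ⟨⟨0, by simp [hT]⟩⟩
  exact ciSup_le fun t => ciSup_le fun z => h t.1 t.2 z.1 z.2

lemma finite_pairs (n : ℕ) : Finite {p : ℕ × ℕ // p.1 + p.2 ≤ n} := by
  have : Set.Finite {p : ℕ × ℕ | p.1 + p.2 ≤ n} := by
    refine Set.Finite.subset ((Set.finite_Iic n).prod (Set.finite_Iic n)) ?_
    rintro ⟨a, b⟩ h
    simp only [mem_ofPred_eq, mem_prod, mem_Iic] at h ⊢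
    omega
  exact this

lemma le_supNT (T : ℝ) (n : ℕ) (y : ℝ → ℝ → ℝ) (j k : ℕ) (h : j + k ≤ n) :
    supT T (fun t => Ddot^[k] (dt^[j] y t)) ≤ supNT T n y := by
  have := finite_pairs n
  exact le_ciSup (f := fun p : {p : ℕ × ℕ // p.1 + p.2 ≤ n} =>
    supT T (fun t => Ddot^[p.1.2] (dt^[p.1.1] y t))) (Set.finite_range _).bddAbove ⟨(j, k), h⟩

lemma supNT_nonneg (T : ℝ) (n : ℕ) (y : ℝ → ℝ → ℝ) : 0 ≤ supNT T n y :=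
  Real.iSup_nonneg fun _ => supT_nonneg _ _

lemma le_supNT0 (T : ℝ) (n : ℕ) (y : ℝ → ℝ → ℝ) (j : ℕ) (h : j ≤ n) :
    supT T (dt^[j] y) ≤ supNT T n y := le_supNT T n y j 0 h

/-- Landau-type interpolation for sup norms. -/
lemma landau {T : ℝ} (hT : 0 < T) {u : ℝ → ℝ → ℝ} (hu : Sm u) {ε : ℝ} (h0 : 0 < ε) (h1 : ε ≤ 1) :
    supT T (dt u) ≤ (4 / T + T + 1) * (supT T u / ε + ε * supT T (dt (dt u))) := by
  set A := supT T u
  set D := supT T (dt (dt u))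
  have hA : 0 ≤ A := supT_nonneg _ _
  have hD : 0 ≤ D := supT_nonneg _ _
  refine supT_le hT.le fun t ht z hz => ?_
  set h := ε * (T / 2) with hh
  have hpos : 0 < h := by positivity
  have hle : h ≤ T / 2 := by
    rw [hh]; nlinarith
  -- a subinterval of length `h` containing `t`
  obtain ⟨a, ha0, haT, hta⟩ : ∃ a, 0 ≤ a ∧ a + h ≤ T ∧ t ∈ Icc a (a + h) := by
    rcases le_total t (T / 2) with h2 | h2
    · exact ⟨t, ht.1, by linarith, le_rfl, by linarith⟩
    · exact ⟨t - h, by linarith, by linarith [ht.2], by linarith, by linarith⟩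
  obtain ⟨c, hc, hceq⟩ := exists_hasDerivAt_eq_slope (fun s => u s z) (fun s => dt u s z)
    (show a < a + h by linarith) (hu.ct.slice_t z).continuousOn
    (fun s _ => hu.hasDerivAt_t s z)
  have hcI : c ∈ Icc (0:ℝ) T := ⟨by linarith [hc.1], by linarith [hc.2]⟩
  have b1 : |dt u c z| ≤ 2 * A / h := by
    rw [hceq, abs_div]
    have : |a + h - a| = h := by rw [add_sub_cancel_left, abs_of_pos hpos]
    rw [this]
    refine div_le_div_of_nonneg_right ?_ hpos.le
    have e1 := le_supT hu.ct (T := T) (t := a + h) (z := z) ⟨by linarith, haT⟩ hz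
    have e2 := le_supT hu.ct (T := T) (t := a) (z := z) ⟨ha0, by linarith⟩ hz
    calc |u (a + h) z - u a z| ≤ |u (a + h) z| + |u a z| := abs_sub _ _
      _ ≤ A + A := add_le_add e1 e2
      _ = 2 * A := by ring
  have b2 : |dt u t z - dt u c z| ≤ D * |t - c| := by
    have := Convex.norm_image_sub_le_of_norm_hasDerivWithin_le (s := Icc (0:ℝ) T) (C := D)
      (f := fun s => dt u s z) (f' := fun s => dt (dt u) s z)
      (fun s _ => (hu.dt.hasDerivAt_t s z).hasDerivWithinAt)
      (fun s hs => le_supT hu.dt.dt.ct hs hz) (convex_Icc _ _) hcI ht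
    exact this
  have b3 : |t - c| ≤ h := by
    rw [abs_le]; constructor <;> linarith [hc.1, hc.2, hta.1, hta.2]
  have b4 : |dt u t z| ≤ 2 * A / h + D * h := by
    have : |dt u t z| ≤ |dt u t z - dt u c z| + |dt u c z| := by
      have := abs_add_le (dt u t z - dt u c z) (dt u c z)
      simpa using this
    have := mul_le_mul_of_nonneg_left b3 hD
    linarith
  refine b4.trans ?_
  have e : 2 * A / h + D * h = 4 / T * (A / ε) + T / 2 * (ε * D) := by
    rw [hh]; field_simp; ring
  rw [e]
  have p1 : 0 ≤ A / ε := by positivity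
  have p2 : 0 ≤ ε * D := by positivity
  have p3 : 0 ≤ 4 / T := by positivity
  nlinarith [mul_nonneg p3 p2, mul_nonneg hT.le p1, mul_nonneg hT.le p2]

/-- Cumulative time sup norms. -/
noncomputable def BB (T : ℝ) (b : ℝ → ℝ → ℝ) (k : ℕ) : ℝ := ∑ i ∈ Finset.range (k + 1), supT T (dt^[i] b)

lemma BB_nonneg (T : ℝ) (b : ℝ → ℝ → ℝ) (k : ℕ) : 0 ≤ BB T b k :=
  Finset.sum_nonneg fun _ _ => supT_nonneg _ _

lemma BB_succ (T : ℝ) (b : ℝ → ℝ → ℝ) (k : ℕ) : BB T b (k + 1) = BB T b k + supT T (dt^[k + 1] b) := by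
  unfold BB; rw [Finset.sum_range_succ]

lemma supT_le_BB (T : ℝ) (b : ℝ → ℝ → ℝ) (k : ℕ) : supT T (dt^[k] b) ≤ BB T b k :=
  Finset.single_le_sum (f := fun i => supT T (dt^[i] b)) (fun _ _ => supT_nonneg _ _)
    (by simp)

lemma BB_le (T : ℝ) (b : ℝ → ℝ → ℝ) {k n : ℕ} (h : k ≤ n) : BB T b k ≤ (k + 1) * supNT T n b := by
  unfold BB
  refine (Finset.sum_le_card_nsmul _ _ (supNT T n b) fun i hi => ?_).trans ?_
  · exact le_supNT0 T n b i (by simp at hi; omega)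
  · simp

lemma BB_interp {T : ℝ} (hT : 0 < T) {b : ℝ → ℝ → ℝ} (hb : Sm b) (k : ℕ) {ε : ℝ} (h0 : 0 < ε)
    (h1 : ε ≤ 1) :
    BB T b (k + 1) ≤ (4 / T + T + 2) * (BB T b k / ε + ε * BB T b (k + 2)) := by
  have hs : ∑ i ∈ Finset.range (k + 1), supT T (dt^[i + 1] b) ≤
      (4 / T + T + 1) * (BB T b k / ε + ε * BB T b (k + 2)) := by
    have : ∀ i ∈ Finset.range (k + 1), supT T (dt^[i + 1] b) ≤
        (4 / T + T + 1) * (supT T (dt^[i] b) / ε + ε * supT T (dt^[i + 2] b)) := by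
      intro i _
      have := landau hT (hb.dt_iter i) h0 h1
      simpa only [← Function.iterate_succ_apply' (f := dt)] using this
    refine (Finset.sum_le_sum this).trans ?_
    rw [← Finset.mul_sum, Finset.sum_add_distrib, ← Finset.sum_div, ← Finset.mul_sum]
    refine mul_le_mul_of_nonneg_left ?_ (by positivity)
    refine add_le_add le_rfl (mul_le_mul_of_nonneg_left ?_ h0.le)
    unfold BB
    rw [Finset.sum_range_succ' _ (k + 2), Finset.sum_range_succ' _ (k + 1)]
    have := supT_nonneg T (dt^[0] b)
    have := supT_nonneg T (dt^[0 + 1] b)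
    linarith
  have e : BB T b (k + 1) = ∑ i ∈ Finset.range (k + 1), supT T (dt^[i + 1] b) + supT T b := by
    unfold BB; rw [Finset.sum_range_succ' _ (k + 1)]; rfl
  have hb0 : supT T b ≤ BB T b k := by
    unfold BB; rw [Finset.sum_range_succ' _ k]
    have := Finset.sum_nonneg (s := Finset.range k) (f := fun i => supT T (dt^[i + 1] b))
      fun _ _ => supT_nonneg _ _
    simpa using this
  have hB := BB_nonneg T b k
  have hB2 := mul_nonneg h0.le (BB_nonneg T b (k + 2))
  have : BB T b k ≤ BB T b k / ε := by
    rw [le_div_iff₀ h0]; nlinarith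
  rw [e]; linarith

lemma BB_log {T : ℝ} (hT : 0 < T) {b : ℝ → ℝ → ℝ} (hb : Sm b) (k : ℕ) :
    BB T b (k + 1) ^ 2 ≤ 4 * (4 / T + T + 2) ^ 2 * (BB T b k * BB T b (k + 2)) := by
  refine opt_eps (BB_nonneg _ _ _) (BB_nonneg _ _ _) ?_ (by positivity)
    fun ε h0 h1 => BB_interp hT hb k h0 h1
  rw [BB_succ, BB_succ]
  have := supT_nonneg T (dt^[k + 1] b)
  have := supT_nonneg T (dt^[k + 1 + 1] b)
  linarith

/-! ### Discrete convexity -/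

lemma logconv_max (Q : ℕ → ℝ) (h0 : ∀ i, 0 ≤ Q i) (n : ℕ)
    (h : ∀ i, i + 2 ≤ n → Q (i + 1) ^ 2 ≤ Q i * Q (i + 2)) :
    ∀ i ≤ n, Q i ≤ max (Q 0) (Q n) := by
  induction n with
  | zero => intro i hi; obtain rfl : i = 0 := by omega
            simp
  | succ n ih =>
    have ih' := ih fun i hi => h i (by omega)
    have key : Q n ≤ max (Q 0) (Q (n + 1)) := by
      rcases n with _ | m
      · simp
      · by_contra hc
        rw [not_le, max_lt_iff] at hc
        have h1 := ih' m (by omega)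
        rw [max_eq_right hc.1.le] at h1
        have h2 := h m (by omega)
        have h3 := h0 (m + 1 + 1)
        have h4 : 0 < Q (m + 1) := (h0 0).trans_lt hc.1
        have h5 := mul_le_mul_of_nonneg_right h1 h3
        have h6 := mul_lt_mul_of_pos_left hc.2 h4
        have : Q (m + 2) = Q (m + 1 + 1) := rfl
        rw [this] at h2
        nlinarith
    intro i hi
    rcases Nat.lt_or_ge n i with hlt | hge
    · obtain rfl : i = n + 1 := by omega
      exact le_max_right _ _
    · exact (ih' i hge).trans (max_le (le_max_left _ _) key)

lemma logconv (P : ℕ → ℝ) (h0 : ∀ i, 0 ≤ P i) (n : ℕ) {K : ℝ} (hK : 1 ≤ K)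
    (h : ∀ i, i + 2 ≤ n → P (i + 1) ^ 2 ≤ K * (P i * P (i + 2))) :
    ∀ i ≤ n, P i ≤ K ^ (n ^ 2) * (P 0 + P n) := by
  intro i hi
  have hK0 : 0 < K := by linarith
  have := logconv_max (fun i => K ^ (i ^ 2) * P i) (fun i => mul_nonneg (by positivity) (h0 i)) n
    (fun i hi => by
      have h1 := h i hi
      have h2 : (0:ℝ) ≤ K ^ (2 * (i + 1) ^ 2) := by positivity
      have h3 := mul_le_mul_of_nonneg_left h1 h2
      have e1 : (K ^ ((i + 1) ^ 2) * P (i + 1)) ^ 2 = K ^ (2 * (i + 1) ^ 2) * P (i + 1) ^ 2 := by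
        ring
      have e2 : K ^ (i ^ 2) * P i * (K ^ ((i + 2) ^ 2) * P (i + 2)) =
          K * (K ^ (2 * (i + 1) ^ 2) * (K * (P i * P (i + 2)))) := by ring
      simp only [e1, e2]
      refine h3.trans (le_mul_of_one_le_left ?_ hK)
      have := mul_nonneg (h0 i) (h0 (i + 2))
      positivity) i hi
  have h1 : P i ≤ K ^ (i ^ 2) * P i := le_mul_of_one_le_left (h0 i) (one_le_pow₀ hK)
  refine (h1.trans this).trans (max_le ?_ ?_)
  · have : (K ^ (0 ^ 2) : ℝ) ≤ K ^ (n ^ 2) := pow_le_pow_right₀ hK (by simp)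
    calc K ^ (0 ^ 2) * P 0 ≤ K ^ (n ^ 2) * P 0 := mul_le_mul_of_nonneg_right this (h0 0)
      _ ≤ _ := mul_le_mul_of_nonneg_left (by linarith [h0 n]) (by positivity)
  · exact mul_le_mul_of_nonneg_left (by linarith [h0 0]) (by positivity)

/-- Tame product bound for a single term. -/
lemma tame {T : ℝ} (hT : 0 < T) (n : ℕ) : ∃ C > (0:ℝ), ∀ N : ℝ, 4 ≤ N → ∀ b u : ℝ → ℝ → ℝ,
    Sm b → Sm u → ∀ τ > 0, (∀ t ∈ Icc (0:ℝ) τ, ∀ z, u t z = 0) → ∀ i ≤ n,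
    BB T b (i + 1) ^ 2 * QQ N T (dt^[n - i] u) ≤
      C * (BB T b 1 ^ 2 * QQ N T (dt^[n] u) + BB T b (n + 1) ^ 2 * QQ N T u) := by
  set K := (4 * (4 / T + T + 2) ^ 2) ^ 2 * 36 with hK
  have hK1 : 1 ≤ K := by
    have h1 : (1:ℝ) ≤ 4 / T + T + 2 := by
      have : 0 < 4 / T := by positivity
      linarith
    have h2 : (1:ℝ) ≤ (4 / T + T + 2) ^ 2 := one_le_pow₀ h1
    have h3 : (1:ℝ) ≤ (4 * (4 / T + T + 2) ^ 2) ^ 2 := one_le_pow₀ (by linarith)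
    rw [hK]; linarith
  refine ⟨K ^ (n ^ 2), by positivity, ?_⟩
  intro N hN b u hb hu τ hτ h0 i hi
  have hv : ∀ k z, dt^[k] u 0 z = 0 := fun k z =>
    dt_iter_vanish hu hτ (fun t ht => h0 t ht z) k 0 ⟨le_rfl, hτ.le⟩
  have := logconv (fun i => BB T b (i + 1) ^ 2 * QQ N T (dt^[n - i] u))
    (fun i => mul_nonneg (sq_nonneg _) (QQ_nonneg N hT.le _)) n hK1 (fun i hi => by
      have h1 := BB_log hT hb (i + 1)
      obtain ⟨m, hm⟩ : ∃ m, n = i + 2 + m := ⟨n - (i + 2), by omega⟩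
      have e0 : n - i = m + 2 := by omega
      have e1 : n - (i + 1) = m + 1 := by omega
      have e2 : n - (i + 2) = m := by omega
      have h2 := interp_QQ hN hT.le (hu.dt_iter m) (hv m)
        (by intro z; have := hv (m + 1) z; rwa [Function.iterate_succ_apply'] at this)
      simp only [e0, e1, e2]
      simp only [← Function.iterate_succ_apply' (f := dt)] at h2
      have h3 : (BB T b (i + 1 + 1) ^ 2) ^ 2 ≤
          (4 * (4 / T + T + 2) ^ 2 * (BB T b (i + 1) * BB T b (i + 1 + 2))) ^ 2 :=
        pow_le_pow_left₀ (sq_nonneg _) h1 2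
      have h4 := mul_le_mul h3 h2 (sq_nonneg _) (sq_nonneg _)
      calc _ = (BB T b (i + 1 + 1) ^ 2) ^ 2 * QQ N T (dt^[m + 1] u) ^ 2 := by ring
        _ ≤ _ := h4
        _ = _ := by rw [hK]; ring) i hi
  simpa using this

/-- Commutator bound. -/
lemma comm_bound {T : ℝ} (hT : 0 < T) (j : ℕ) : ∃ C > (0:ℝ), ∀ N : ℝ, 4 ≤ N → ∀ b u : ℝ → ℝ → ℝ,
    Sm b → Sm u → ∀ τ > 0, (∀ t ∈ Icc (0:ℝ) τ, ∀ z, u t z = 0) →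
    QQ N T (fun t z => dt^[j] (fun t z => b t z * u t z) t z - b t z * dt^[j] u t z) ≤
      C * (supNT T 6 b ^ 2 * QQ N T (dt^[j - 1] u) + supNT T (j + 4) b ^ 2 * QQ N T u) := by
  rcases j with _ | n
  · refine ⟨1, one_pos, ?_⟩
    intro N hN b u hb hu τ hτ h0
    have : QQ N T (fun t z => dt^[0] (fun t z => b t z * u t z) t z - b t z * dt^[0] u t z) = 0 := by
      simp [QQ, II]
    rw [this]
    have h1 := QQ_nonneg N hT.le (dt^[0 - 1] u)
    have h2 := QQ_nonneg N hT.le u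
    positivity
  · obtain ⟨C, hC, htame⟩ := tame hT n
    set R : ℝ := ∑ i ∈ Finset.range (n + 1), (((n + 1).choose (i + 1) : ℕ) : ℝ) ^ 2 with hR
    have hR0 : 0 < R := by
      rw [hR, Finset.sum_range_succ]
      have : 0 ≤ ∑ i ∈ Finset.range n, (((n + 1).choose (i + 1) : ℕ) : ℝ) ^ 2 :=
        Finset.sum_nonneg fun _ _ => sq_nonneg _
      simp; linarith
    refine ⟨(n + 1) * (R * (C * ((n + 2) ^ 2 + 4))), by positivity, ?_⟩
    intro N hN b u hb hu τ hτ h0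
    have e : (fun t z => dt^[n + 1] (fun t z => b t z * u t z) t z - b t z * dt^[n + 1] u t z) =
        fun t z => ∑ i ∈ Finset.range (n + 1),
          (((n + 1).choose (i + 1) : ℕ) : ℝ) * (dt^[i + 1] b t z * dt^[n - i] u t z) := by
      funext t z
      rw [dt_iter_mul hb hu, Finset.sum_range_succ']
      simp [mul_assoc]
    rw [e]
    have hq1 := QQ_nonneg N hT.le (dt^[n] u)
    have hq2 := QQ_nonneg N hT.le u
    have hB1 : BB T b 1 ^ 2 ≤ 4 * supNT T 6 b ^ 2 := by
      have := BB_le T b (k := 1) (n := 6) (by norm_num)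
      have := pow_le_pow_left₀ (BB_nonneg T b 1) this 2
      refine this.trans (le_of_eq ?_)
      push_cast; ring
    have hB2 : BB T b (n + 1) ^ 2 ≤ (n + 2) ^ 2 * supNT T (n + 1 + 4) b ^ 2 := by
      have := BB_le T b (k := n + 1) (n := n + 1 + 4) (by omega)
      have := pow_le_pow_left₀ (BB_nonneg T b (n + 1)) this 2
      refine this.trans (le_of_eq ?_)
      push_cast; ring
    set S := supNT T 6 b ^ 2 * QQ N T (dt^[n] u) + supNT T (n + 1 + 4) b ^ 2 * QQ N T u with hS
    have hterm : ∀ i ∈ Finset.range (n + 1),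
        QQ N T (fun t z => (((n + 1).choose (i + 1) : ℕ) : ℝ) * (dt^[i + 1] b t z * dt^[n - i] u t z))
        ≤ (((n + 1).choose (i + 1) : ℕ) : ℝ) ^ 2 * (C * (((n:ℝ) + 2) ^ 2 + 4) * S) := by
      intro i hi
      rw [QQ_smul]
      refine mul_le_mul_of_nonneg_left ?_ (sq_nonneg _)
      have h1 := QQ_bdd_mul hN hT.le (hb.dt_iter (i + 1)).ct (hu.dt_iter (n - i)).ct
        (B := BB T b (i + 1)) fun t ht z hz =>
          (le_supT (hb.dt_iter (i + 1)).ct ht hz).trans (supT_le_BB T b (i + 1))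
      have h2 := htame N hN b u hb hu τ hτ h0 i (by simp at hi; omega)
      refine (h1.trans h2).trans ?_
      rw [mul_assoc]
      refine mul_le_mul_of_nonneg_left ?_ hC.le
      have h3 := mul_le_mul_of_nonneg_right hB1 hq1
      have h4 := mul_le_mul_of_nonneg_right hB2 hq2
      have h5 : 0 ≤ supNT T 6 b ^ 2 * QQ N T (dt^[n] u) := by positivity
      have h6 : 0 ≤ supNT T (n + 1 + 4) b ^ 2 * QQ N T u := by positivity
      have h7 : (0:ℝ) ≤ ((n:ℝ) + 2) ^ 2 := by positivity
      rw [hS]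
      nlinarith [mul_nonneg h7 h5]
    have hsum := QQ_sum hN hT.le (Finset.range (n + 1)) (u := fun i t z =>
      (((n + 1).choose (i + 1) : ℕ) : ℝ) * (dt^[i + 1] b t z * dt^[n - i] u t z))
      (fun i _ => (Ct.const _).mul ((hb.dt_iter (i + 1)).ct.mul (hu.dt_iter (n - i)).ct))
    refine hsum.trans ?_
    refine (mul_le_mul_of_nonneg_left (Finset.sum_le_sum hterm) (by positivity)).trans (le_of_eq ?_)
    rw [← Finset.sum_mul, ← hR, Nat.add_sub_cancel, ← hS]
    simp
    ring

lemma comm_bound' {T : ℝ} (hT : 0 < T) (j : ℕ) : ∃ C > (0:ℝ), ∀ N : ℝ, 4 ≤ N → ∀ b u : ℝ → ℝ → ℝ,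
    Sm b → Sm u → ∀ τ > 0, (∀ t ∈ Icc (0:ℝ) τ, ∀ z, u t z = 0) → ∀ A A₂ β M : ℝ, 0 ≤ A →
    (1 ≤ j → QQ N T (dt^[j - 1] u) ≤ A) → QQ N T u ≤ A₂ → supNT T 6 b ≤ M →
    supNT T (j + 4) b ≤ β →
    QQ N T (fun t z => dt^[j] (fun t z => b t z * u t z) t z - b t z * dt^[j] u t z) ≤
      C * (M ^ 2 * A + β ^ 2 * A₂) := by
  obtain ⟨C, hC, h⟩ := comm_bound hT j
  refine ⟨C, hC, ?_⟩
  intro N hN b u hb hu τ hτ h0 A A₂ β M hA hA1 hA2 hM hβ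
  have q2 := QQ_nonneg N hT.le u
  have n1 := supNT_nonneg T 6 b
  have n2 := supNT_nonneg T (j + 4) b
  have p1 := pow_le_pow_left₀ n1 hM 2
  have p2 := pow_le_pow_left₀ n2 hβ 2
  rcases Nat.eq_zero_or_pos j with rfl | hj
  · have : QQ N T (fun t z => dt^[0] (fun t z => b t z * u t z) t z - b t z * dt^[0] u t z) = 0 := by
      simp [QQ, II]
    rw [this]
    have : 0 ≤ A₂ := q2.trans hA2
    positivity
  · refine (h N hN b u hb hu τ hτ h0).trans ?_
    refine mul_le_mul_of_nonneg_left ?_ hC.le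
    have q1 := QQ_nonneg N hT.le (dt^[j - 1] u)
    exact add_le_add (mul_le_mul p1 (hA1 hj) q1 (sq_nonneg _))
      (mul_le_mul p2 hA2 q2 (sq_nonneg _))

/-! ### The energy estimate -/

lemma mul_bound {c x y M : ℝ} (h : |c| ≤ M) : c * (x * y) ≤ M / 2 * (x ^ 2 + y ^ 2) := by
  have h1 : c * (x * y) ≤ |c| * |x * y| := by rw [← abs_mul]; exact le_abs_self _
  have h2 : |x * y| ≤ (x ^ 2 + y ^ 2) / 2 := by
    rw [abs_le]; constructor <;> nlinarith [sq_nonneg (x + y), sq_nonneg (x - y)]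
  have h3 := mul_le_mul h h2 (abs_nonneg _) ((abs_nonneg _).trans h)
  linarith

/-- The operator `√z d/dz` on curried functions. -/
noncomputable def DR (y : ℝ → ℝ → ℝ) : ℝ → ℝ → ℝ := fun t => Ddot (y t)

lemma DR_eq (y : ℝ → ℝ → ℝ) : DR y = fun t z => √z * dz y t z := rfl

lemma Ct.sqrt : Ct (fun _ z => √z) := Ct.ofz Real.continuous_sqrt

lemma Sm.DR_ct {y : ℝ → ℝ → ℝ} (h : Sm y) : Ct (DR y) := Ct.sqrt.mul h.dz.ct

lemma Xnorm_sq (N : ℝ) (f : ℝ → ℝ) : Xnorm N f ^ 2 = ∫ z in (0:ℝ)..1, (f z) ^ 2 * W N z := by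
  unfold Xnorm
  rw [Real.sq_sqrt]
  · rfl
  · exact intervalIntegral.integral_nonneg zero_le_one fun z hz =>
      mul_nonneg (sq_nonneg _) (W_nonneg N hz)

lemma normN_sq (N : ℝ) (n : ℕ) (f : ℝ → ℝ) :
    normN N n f ^ 2 = ∑ ℓ ∈ Finset.range (n + 1), (gnorm N ℓ f) ^ 2 :=
  Real.sq_sqrt (Finset.sum_nonneg fun _ _ => sq_nonneg _)

lemma gnorm_zero_sq (N : ℝ) (f : ℝ → ℝ) :
    gnorm N 0 f ^ 2 = ∫ z in (0:ℝ)..1, (f z) ^ 2 * W N z := by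
  rw [← Xnorm_sq]; rfl

lemma gnorm_one_sq (N : ℝ) (f : ℝ → ℝ) :
    gnorm N 1 f ^ 2 = ∫ z in (0:ℝ)..1, (Ddot f z) ^ 2 * W N z := by
  rw [← Xnorm_sq]; rfl

lemma gnorm_two_sq (N : ℝ) (f : ℝ → ℝ) :
    gnorm N 2 f ^ 2 = ∫ z in (0:ℝ)..1, (Del N f z) ^ 2 * W N z := by
  rw [← Xnorm_sq]; rfl

lemma normN_one_sq {N : ℝ} {y : ℝ → ℝ → ℝ} (hy : Sm y) (hN : 4 ≤ N) (t : ℝ) :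
    normN N 1 (y t) ^ 2 = ∫ z in (0:ℝ)..1, (y t z ^ 2 * W N z + DR y t z ^ 2 * W N z) := by
  rw [normN_sq, Finset.sum_range_succ, Finset.sum_range_one, gnorm_zero_sq, gnorm_one_sq]
  exact (intervalIntegral.integral_add
    (((hy.ct.sq.mul (Ct.W hN)).slice t).intervalIntegrable _ _)
    (((hy.DR_ct.sq.mul (Ct.W hN)).slice t).intervalIntegrable _ _)).symm

lemma int_normN_zero (N T : ℝ) (y : ℝ → ℝ → ℝ) :
    ∫ t in (0:ℝ)..T, normN N 0 (y t) ^ 2 = QQ N T y := by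
  simp only [normN_sq, Finset.sum_range_one, gnorm_zero_sq, zero_add]
  rfl

lemma int_normN_one {N : ℝ} (hN : 4 ≤ N) (T : ℝ) {y : ℝ → ℝ → ℝ} (hy : Sm y) :
    ∫ t in (0:ℝ)..T, normN N 1 (y t) ^ 2 = QQ N T y + QQ N T (DR y) := by
  simp only [normN_one_sq hy hN]
  exact II_add (hy.ct.sq.mul (Ct.W hN)) (hy.DR_ct.sq.mul (Ct.W hN)) T

lemma int_normN_two {N : ℝ} (hN : 4 ≤ N) (T : ℝ) {y : ℝ → ℝ → ℝ} (hy : Sm y) :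
    ∫ t in (0:ℝ)..T, normN N 2 (y t) ^ 2 = QQ N T y + QQ N T (DR y) + QQ N T (Lap N y) := by
  simp only [normN_sq, Finset.sum_range_succ, Finset.sum_range_one, gnorm_zero_sq, zero_add,
    gnorm_one_sq, gnorm_two_sq, Finset.range_one, Finset.sum_singleton]
  have k1 := hy.ct.sq.mul (Ct.W hN)
  have k2 := hy.DR_ct.sq.mul (Ct.W hN)
  have k3 := (hy.lap N).ct.sq.mul (Ct.W hN)
  exact (intervalIntegral.integral_add ((k1.inner.add k2.inner).intervalIntegrable _ _)
    (k3.inner.intervalIntegrable _ _)).trans (congrArg (· + QQ N T (Lap N y))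
      (intervalIntegral.integral_add (k1.inner.intervalIntegrable _ _)
      (k2.inner.intervalIntegrable _ _)))

lemma int_le_normT (N : ℝ) {T : ℝ} (hT : 0 ≤ T) (n j k : ℕ) (h : j + k ≤ n) (y : ℝ → ℝ → ℝ) :
    ∫ t in (0:ℝ)..T, normN N k (dt^[j] y t) ^ 2 ≤ normT N T n y ^ 2 := by
  have nn : ∀ j k, 0 ≤ ∫ t in (0:ℝ)..T, normN N k (dt^[j] y t) ^ 2 := fun j k =>
    intervalIntegral.integral_nonneg hT fun _ _ => sq_nonneg _
  unfold normT
  rw [Real.sq_sqrt (Finset.sum_nonneg fun j _ => Finset.sum_nonneg fun k _ => nn j k)]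
  have h1 := Finset.single_le_sum (f := fun k => ∫ t in (0:ℝ)..T, normN N k (dt^[j] y t) ^ 2)
    (s := Finset.range (n + 1 - j)) (fun k _ => nn j k) (a := k) (by simp; omega)
  refine h1.trans ?_
  exact Finset.single_le_sum (f := fun j => ∑ k ∈ Finset.range (n + 1 - j),
    ∫ t in (0:ℝ)..T, normN N k (dt^[j] y t) ^ 2)
    (s := Finset.range (n + 1)) (fun j _ => Finset.sum_nonneg fun k _ => nn j k) (a := j)
    (by simp; omega)

lemma flux {N : ℝ} (hN : 4 ≤ N) {f : ℝ → ℝ → ℝ} (hf : Sm f) (t : ℝ) (h1 : f t 1 = 0) :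
    ∫ z in (0:ℝ)..1, (z * dz f t z + N / 2 * f t z) * W N z = 0 := by
  have hp : (1:ℝ) ≤ N / 2 := by linarith
  have hz : ∀ z ∈ uIcc (0:ℝ) 1, HasDerivAt (fun z => f t z * z ^ (N / 2))
      ((z * dz f t z + N / 2 * f t z) * W N z) z := by
    intro z hz
    rw [uIcc_of_le zero_le_one] at hz
    refine ((hf.hasDerivAt_z t z).mul (Real.hasDerivAt_rpow_const (Or.inr hp))).congr_deriv ?_
    have e : z ^ (N / 2) = z ^ (N / 2 - 1) * z := by
      have := Real.rpow_add_one' hz.1 (y := N / 2 - 1) (by linarith)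
      rwa [sub_add_cancel] at this
    rw [e, W]; ring
  have hc : Continuous (fun z => (z * dz f t z + N / 2 * f t z) * W N z) :=
    Ct.slice (((Ct.snd.mul hf.dz.ct).add ((Ct.const _).mul hf.ct)).mul (Ct.W hN)) t
  rw [intervalIntegral.integral_eq_sub_of_hasDerivAt hz (hc.intervalIntegrable _ _)]
  rw [h1, Real.zero_rpow (by linarith)]; simp

lemma dz_mul {f g : ℝ → ℝ → ℝ} (hf : Sm f) (hg : Sm g) (t z : ℝ) :
    dz (fun t z => f t z * g t z) t z = dz f t z * g t z + f t z * dz g t z :=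
  ((hf.hasDerivAt_z t z).mul (hg.hasDerivAt_z t z)).deriv

lemma energy {N : ℝ} (hN : 4 ≤ N) {T M : ℝ} (hM : 0 ≤ M)
    {b₂ b₁ b₀ F h : ℝ → ℝ → ℝ} (hb₂ : Sm b₂) (hF : Ct F) (hh : Sm h)
    (hlow : ∀ t ∈ Icc (0:ℝ) T, ∀ z ∈ Icc (0:ℝ) 1, 1 / 2 ≤ b₂ t z)
    (m1 : ∀ t ∈ Icc (0:ℝ) T, ∀ z ∈ Icc (0:ℝ) 1, |b₁ t z| ≤ M)
    (m0 : ∀ t ∈ Icc (0:ℝ) T, ∀ z ∈ Icc (0:ℝ) 1, |b₀ t z| ≤ M)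
    (mt : ∀ t ∈ Icc (0:ℝ) T, ∀ z ∈ Icc (0:ℝ) 1, |dt b₂ t z| ≤ M)
    (mz : ∀ t ∈ Icc (0:ℝ) T, ∀ z ∈ Icc (0:ℝ) 1, |√z * dz b₂ t z| ≤ M)
    (heq : ∀ t ∈ Icc (0:ℝ) T, ∀ z ∈ Icc (0:ℝ) 1, dt (dt h) t z =
      F t z + b₂ t z * Lap N h t z - b₁ t z * DD h t z - b₀ t z * h t z)
    (hbd : ∀ t ∈ Icc (0:ℝ) T, dt h t 1 = 0)
    (h0 : ∀ z, h 0 z = 0) (h1 : ∀ z, dt h 0 z = 0) (s : ℝ) (hs : s ∈ Icc (0:ℝ) T) :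
    normN N 1 (h s) ^ 2 ≤
      4 * (QQ N T F + (2 * M + 2) * (QQ N T (dt h) + QQ N T (DR h) + QQ N T h)) := by
  set v := dt h with hv
  set p := dz h with hp
  have sv : Sm v := hh.dt
  have sp : Sm p := hh.dz
  set e : ℝ → ℝ → ℝ := fun t z => ((1 / 2) * (v t z * v t z) +
    (z / 2) * (b₂ t z * (p t z * p t z))) + (1 / 2) * (h t z * h t z) with he
  have s1 := sv.mul sv
  have s2 := hb₂.mul (sp.mul sp)
  have s3 := hh.mul hh
  have c1 := (Sm.const (1 / 2)).mul s1
  have c2 : Sm (fun t z => (z / 2) * (b₂ t z * (p t z * p t z))) := by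
    have := (Sm.const (1 / 2)).mul (Sm.snd.mul s2)
    convert this using 3
    ring
  have c3 := (Sm.const (1 / 2)).mul s3
  have se : Sm e := (c1.add c2).add c3
  have hde : dt e = fun t z => v t z * dt v t z + (z / 2) * (dt b₂ t z * (p t z * p t z)) +
      z * (b₂ t z * (p t z * dz v t z)) + h t z * v t z := by
    rw [he, dt_add (c1.add c2) c3, dt_add c1 c2, dt_zmul (fun _ => 1 / 2) s1,
      dt_zmul (fun z => z / 2) s2, dt_zmul (fun _ => 1 / 2) s3, dt_mul sv sv, dt_mul hh hh,
      dt_mul hb₂ (sp.mul sp), dt_mul sp sp, hp, hh.dt_dz]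
    funext t z; ring
  have hI := II_dt hN se s (fun z _ => by
    have : p 0 z = 0 := by
      have : h 0 = fun _ => 0 := funext h0
      simp [hp, dz, this]
    simp [he, h0, h1, this])
  -- the flux
  set f : ℝ → ℝ → ℝ := fun t z => b₂ t z * (p t z * v t z) with hf
  have sf : Sm f := hb₂.mul (sp.mul sv)
  set g : ℝ → ℝ → ℝ := fun t z => (z * dz f t z + N / 2 * f t z) * W N z with hg
  have cg : Ct g := ((Ct.snd.mul sf.dz.ct).add ((Ct.const _).mul sf.ct)).mul (Ct.W hN)
  have hg0 : II s g = 0 := by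
    unfold II
    rw [intervalIntegral.integral_congr (g := fun _ => (0:ℝ))]
    · simp
    · intro t ht
      rw [uIcc_of_le hs.1] at ht
      exact flux hN sf t (by simp [hf, hbd t ⟨ht.1, ht.2.trans hs.2⟩])
  set R : ℝ → ℝ → ℝ := fun t z => (F t z) ^ 2 * W N z + (2 * M + 2) *
    ((v t z ^ 2 * W N z + DR h t z ^ 2 * W N z) + h t z ^ 2 * W N z) with hR
  have k1 := hF.sq.mul (Ct.W hN)
  have k2 := sv.ct.sq.mul (Ct.W hN)
  have k3 := hh.DR_ct.sq.mul (Ct.W hN)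
  have k4 := hh.ct.sq.mul (Ct.W hN)
  have cR : Ct R := k1.add ((Ct.const _).mul ((k2.add k3).add k4))
  have hRT : II T R = QQ N T F + (2 * M + 2) * (QQ N T v + QQ N T (DR h) + QQ N T h) := by
    rw [hR, II_add k1 ((Ct.const _).mul ((k2.add k3).add k4)), II_smul,
      II_add (k2.add k3) k4, II_add k2 k3]
    rfl
  have cde := se.dt.ct.mul (Ct.W hN)
  have hmain : II s (fun t z => dt e t z * W N z) ≤ II s R := by
    have e1 : II s (fun t z => dt e t z * W N z) =
        II s (fun t z => dt e t z * W N z + (-1) * g t z) := by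
      rw [II_add cde ((Ct.const _).mul cg), II_smul, hg0]; ring
    rw [e1]
    refine II_mono (cde.add ((Ct.const _).mul cg)) cR hs.1 fun t ht z hz => ?_
    have ht' : t ∈ Icc (0:ℝ) T := ⟨ht.1, ht.2.trans hs.2⟩
    have hw := W_nonneg N hz
    have hr : √z * √z = z := Real.mul_self_sqrt hz.1
    have hr1 : √z ≤ 1 := Real.sqrt_le_one.2 hz.2
    have hr0 : 0 ≤ √z := Real.sqrt_nonneg z
    have key : dt e t z - (z * dz f t z + N / 2 * f t z) ≤ (F t z) ^ 2 + (2 * M + 2) *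
        ((v t z ^ 2 + DR h t z ^ 2) + h t z ^ 2) := by
      have hfz : dz f t z = dz b₂ t z * (p t z * v t z) +
          b₂ t z * (dz p t z * v t z + p t z * dz v t z) := by
        rw [hf, dz_mul hb₂ (sp.mul sv), dz_mul sp sv]
      have q1 := heq t ht' z hz
      rw [hde, hfz]
      simp only [hf]
      rw [q1, Lap_eq, DD, DR_eq]
      simp only [← hp]
      set r := √z
      have B1 : |-(b₁ t z * r)| ≤ M := by
        rw [abs_neg, abs_mul, abs_of_nonneg hr0]
        have := m1 t ht' z hz
        nlinarith [abs_nonneg (b₁ t z)]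
      have a1 := mul_bound (x := r * p t z) (y := v t z) B1
      have a0 := mul_bound (M := M) (c := -(b₀ t z)) (x := h t z) (y := v t z)
        (by rw [abs_neg]; exact m0 t ht' z hz)
      have at' := mul_bound (x := r * p t z) (y := r * p t z) (mt t ht' z hz)
      have az := mul_bound (M := M) (c := -(r * dz b₂ t z)) (x := r * p t z) (y := v t z)
        (by rw [abs_neg]; exact mz t ht' z hz)
      have aF := mul_bound (c := 1) (M := 1) (x := F t z) (y := v t z) (by simp)
      have ah := mul_bound (c := 1) (M := 1) (x := h t z) (y := v t z) (by simp)
      have nv : 0 ≤ M * v t z ^ 2 := by positivity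
      have nP : 0 ≤ M * (r * p t z) ^ 2 := by positivity
      have nh : 0 ≤ M * h t z ^ 2 := by positivity
      have ident : v t z * (F t z + b₂ t z * (z * dz p t z + N / 2 * p t z) - b₁ t z * (z * p t z) -
          b₀ t z * h t z) + z / 2 * (dt b₂ t z * (p t z * p t z)) +
          z * (b₂ t z * (p t z * dz v t z)) + h t z * v t z -
          (z * (dz b₂ t z * (p t z * v t z) + b₂ t z * (dz p t z * v t z + p t z * dz v t z)) +
          N / 2 * (b₂ t z * (p t z * v t z))) =
          1 * (F t z * v t z) + -(b₁ t z * r) * (r * p t z * v t z) + -b₀ t z * (h t z * v t z) +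
          1 / 2 * (dt b₂ t z * (r * p t z * (r * p t z))) +
          -(r * dz b₂ t z) * (r * p t z * v t z) + 1 * (h t z * v t z) := by
        rw [← hr]; ring
      rw [ident]
      linarith [sq_nonneg (F t z), sq_nonneg (v t z), sq_nonneg (r * p t z), sq_nonneg (h t z)]
    have := mul_le_mul_of_nonneg_right key hw
    simp only [hR, hg]
    linarith
  have hRs : II s R ≤ II T R := by
    refine II_mono_T cR hs fun t _ z hz => ?_
    have := W_nonneg N hz
    positivity
  rw [hI] at hmain
  -- lower bound
  have hlower : normN N 1 (h s) ^ 2 ≤ 4 * ∫ z in (0:ℝ)..1, e s z * W N z := by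
    rw [normN_one_sq hh hN s, ← intervalIntegral.integral_const_mul]
    have cA : Ct (fun t z => h t z ^ 2 * W N z + DR h t z ^ 2 * W N z) := k4.add k3
    have cB : Ct (fun t z => 4 * (e t z * W N z)) := (Ct.const _).mul (se.ct.mul (Ct.W hN))
    refine intervalIntegral.integral_mono_on zero_le_one ((cA.slice s).intervalIntegrable _ _)
      ((cB.slice s).intervalIntegrable _ _) fun z hz => ?_
    have hw := W_nonneg N hz
    have hl := hlow s hs z hz
    have key : h s z ^ 2 + DR h s z ^ 2 ≤ 4 * e s z := by
      have e1 : DR h s z ^ 2 = z * (p s z) ^ 2 := by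
        rw [DR_eq, mul_pow, Real.sq_sqrt hz.1]
      rw [e1]
      simp only [he]
      have n1 : 0 ≤ z * p s z ^ 2 := mul_nonneg hz.1 (sq_nonneg _)
      have n2 := mul_le_mul_of_nonneg_right hl n1
      nlinarith [sq_nonneg (v s z), sq_nonneg (h s z)]
    have := mul_le_mul_of_nonneg_right key hw
    linarith
  calc _ ≤ _ := hlower
    _ ≤ 4 * II T R := by linarith
    _ = _ := by rw [hRT]

lemma QQ_four {N : ℝ} (hN : 4 ≤ N) {T : ℝ} (hT : 0 ≤ T) {a b c d : ℝ → ℝ → ℝ}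
    (ha : Ct a) (hb : Ct b) (hc : Ct c) (hd : Ct d) :
    QQ N T (fun t z => a t z + b t z - c t z - d t z) ≤
      4 * (QQ N T a + QQ N T b + QQ N T c + QQ N T d) := by
  have ka := ha.sq.mul (Ct.W hN)
  have kb := hb.sq.mul (Ct.W hN)
  have kc := hc.sq.mul (Ct.W hN)
  have kd := hd.sq.mul (Ct.W hN)
  unfold QQ
  rw [← II_add ka kb, ← II_add (ka.add kb) kc, ← II_add ((ka.add kb).add kc) kd, ← II_smul]
  refine II_mono ((((ha.add hb).sub hc).sub hd).sq.mul (Ct.W hN))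
    ((Ct.const _).mul (((ka.add kb).add kc).add kd)) hT fun t ht z hz => ?_
  have hw := W_nonneg N hz
  have key : (a t z + b t z - c t z - d t z) ^ 2 ≤
      4 * (a t z ^ 2 + b t z ^ 2 + c t z ^ 2 + d t z ^ 2) := by
    nlinarith [sq_nonneg (a t z - b t z), sq_nonneg (a t z + c t z), sq_nonneg (a t z + d t z),
      sq_nonneg (b t z + c t z), sq_nonneg (b t z + d t z), sq_nonneg (c t z - d t z)]
  have := mul_le_mul_of_nonneg_right key hw
  linarith

theorem stmt14 (N : ℝ) (hN : 4 ≤ N) (T : ℝ) (hT : 0 < T) (j : ℕ) (M : ℝ) (hM : 0 < M) :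
    ∃ C > (0:ℝ), ∀ b₂ b₁ b₀ G H : ℝ → ℝ → ℝ, ∀ τ₂ : ℝ,
      ContDiff ℝ (⊤ : ℕ∞) (fun p : ℝ × ℝ => b₂ p.1 p.2) →
      ContDiff ℝ (⊤ : ℕ∞) (fun p : ℝ × ℝ => b₁ p.1 p.2) →
      ContDiff ℝ (⊤ : ℕ∞) (fun p : ℝ × ℝ => b₀ p.1 p.2) →
      (∀ t ∈ Icc (0:ℝ) T, ∀ z ∈ Icc (0:ℝ) 1, |b₂ t z - 1| ≤ 1 / 2) →
      supNT T 6 b₂ + supNT T 6 b₁ + supNT T 6 b₀ ≤ M →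
      τ₂ ∈ Ioo (0:ℝ) T →
      ContDiff ℝ (⊤ : ℕ∞) (fun p : ℝ × ℝ => G p.1 p.2) →
      (∀ t ∈ Icc (0:ℝ) τ₂, ∀ z : ℝ, G t z = 0) →
      ContDiff ℝ (⊤ : ℕ∞) (fun p : ℝ × ℝ => H p.1 p.2) →
      (∀ t ∈ Icc (0:ℝ) T, ∀ z ∈ Ioo (0:ℝ) 1,
        dt (dt H) t z + opA N b₂ b₁ b₀ H t z = G t z) →
      (∀ t ∈ Icc (0:ℝ) T, H t 1 = 0) →
      (∀ t ∈ Icc (0:ℝ) τ₂, ∀ z : ℝ, H t z = 0) →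
      (⨆ t : Icc (0:ℝ) T, normN N 1 (dt^[j] H t.1))
        ≤ C * (normT N T j G + normT N T (j + 1) H
            + (supNT T (j + 4) b₂ + supNT T (j + 4) b₁ + supNT T (j + 4) b₀) * normT N T 2 H
            + (supNT T (j + 5) b₂ + supNT T (j + 5) b₁ + supNT T (j + 5) b₀)
                * normT N T 1 H) := by
  obtain ⟨C, hC, hcomm⟩ := comm_bound' hT j
  set K : ℝ := 4 * (4 * (1 + 3 * (C * (M ^ 2 + 1))) + (2 * M + 2) * 2) with hK
  have hK0 : 0 < K := by positivity
  refine ⟨√K, Real.sqrt_pos.2 hK0, ?_⟩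
  intro b₂ b₁ b₀ G H τ hb₂ hb₁ hb₀ hb hM6 hτ hG hG0 hH heq hbd hH0
  change Sm b₂ at hb₂
  change Sm b₁ at hb₁
  change Sm b₀ at hb₀
  change Sm G at hG
  change Sm H at hH
  have e2 := supNT_nonneg T 6 b₂
  have e1 := supNT_nonneg T 6 b₁
  have e0 := supNT_nonneg T 6 b₀
  have f2 := supNT_nonneg T (j + 4) b₂
  have f1 := supNT_nonneg T (j + 4) b₁
  have f0 := supNT_nonneg T (j + 4) b₀
  have g2 := supNT_nonneg T (j + 5) b₂
  have g1 := supNT_nonneg T (j + 5) b₁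
  have g0 := supNT_nonneg T (j + 5) b₀
  set β := supNT T (j + 4) b₂ + supNT T (j + 4) b₁ + supNT T (j + 4) b₀ with hβ
  set γ := supNT T (j + 5) b₂ + supNT T (j + 5) b₁ + supNT T (j + 5) b₀ with hγ
  have hβ0 : 0 ≤ β := by positivity
  have hγ0 : 0 ≤ γ := by positivity
  have nG : 0 ≤ normT N T j G := Real.sqrt_nonneg _
  have nJ : 0 ≤ normT N T (j + 1) H := Real.sqrt_nonneg _
  have n2 : 0 ≤ normT N T 2 H := Real.sqrt_nonneg _
  have n1 : 0 ≤ normT N T 1 H := Real.sqrt_nonneg _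
  set X := normT N T j G + normT N T (j + 1) H + β * normT N T 2 H + γ * normT N T 1 H with hX
  have hβ2 : 0 ≤ β * normT N T 2 H := mul_nonneg hβ0 n2
  have hγ1 : 0 ≤ γ * normT N T 1 H := mul_nonneg hγ0 n1
  have hX0 : 0 ≤ X := by positivity
  have xG : normT N T j G ^ 2 ≤ X ^ 2 := pow_le_pow_left₀ nG (by linarith) 2
  have xJ : normT N T (j + 1) H ^ 2 ≤ X ^ 2 := pow_le_pow_left₀ nJ (by linarith) 2
  have x2 : β ^ 2 * normT N T 2 H ^ 2 ≤ X ^ 2 := by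
    rw [← mul_pow]; exact pow_le_pow_left₀ hβ2 (by linarith) 2
  -- the equation on the closed rectangle
  have heq' : ∀ t ∈ Icc (0:ℝ) T, ∀ z ∈ Icc (0:ℝ) 1, dt (dt H) t z =
      G t z + b₂ t z * Lap N H t z - b₁ t z * DD H t z - b₀ t z * H t z := by
    intro t ht
    have cl : Continuous (fun z => dt (dt H) t z) := hH.dt.dt.ct.slice t
    have cr : Continuous (fun z =>
        G t z + b₂ t z * Lap N H t z - b₁ t z * DD H t z - b₀ t z * H t z) :=
      Ct.slice (((hG.ct.add (hb₂.ct.mul (hH.lap N).ct)).sub (hb₁.ct.mul hH.DD.ct)).sub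
        (hb₀.ct.mul hH.ct)) t
    have h1 : Set.EqOn (fun z => dt (dt H) t z) (fun z =>
        G t z + b₂ t z * Lap N H t z - b₁ t z * DD H t z - b₀ t z * H t z) (Ioo 0 1) := by
      intro z hz
      have := heq t ht z hz
      simp only [opA] at this
      simp only [Lap, DD, dz]
      linarith
    have h2 := h1.closure cl cr
    rw [closure_Ioo (by norm_num)] at h2
    exact h2
  set h := dt^[j] H with hh
  have sh : Sm h := hH.dt_iter j
  -- the three commutators
  set k2 : ℝ → ℝ → ℝ := fun t z => dt^[j] (fun t z => b₂ t z * Lap N H t z) t z -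
    b₂ t z * dt^[j] (Lap N H) t z with hk2
  set k1 : ℝ → ℝ → ℝ := fun t z => dt^[j] (fun t z => b₁ t z * DD H t z) t z -
    b₁ t z * dt^[j] (DD H) t z with hk1
  set k0 : ℝ → ℝ → ℝ := fun t z => dt^[j] (fun t z => b₀ t z * H t z) t z -
    b₀ t z * dt^[j] H t z with hk0
  have sk2 : Sm k2 := ((hb₂.mul (hH.lap N)).dt_iter j).sub (hb₂.mul ((hH.lap N).dt_iter j))
  have sk1 : Sm k1 := ((hb₁.mul hH.DD).dt_iter j).sub (hb₁.mul (hH.DD.dt_iter j))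
  have sk0 : Sm k0 := ((hb₀.mul hH).dt_iter j).sub (hb₀.mul (hH.dt_iter j))
  set F : ℝ → ℝ → ℝ := fun t z => dt^[j] G t z + k2 t z - k1 t z - k0 t z with hF
  have sF : Sm F := (((hG.dt_iter j).add sk2).sub sk1).sub sk0
  have heqj : ∀ t ∈ Icc (0:ℝ) T, ∀ z ∈ Icc (0:ℝ) 1, dt (dt h) t z =
      F t z + b₂ t z * Lap N h t z - b₁ t z * DD h t z - b₀ t z * h t z := by
    intro t ht z hz
    have q2 := hb₂.mul (hH.lap N)
    have q1 := hb₁.mul hH.DD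
    have q0 := hb₀.mul hH
    have := dt_iter_congr hH.dt.dt (((hG.add q2).sub q1).sub q0) hT
      (fun t ht => heq' t ht z hz) j t ht
    rw [dt_iter_sub ((hG.add q2).sub q1) q0, dt_iter_sub (hG.add q2) q1, dt_iter_add hG q2] at this
    have e : dt (dt h) = dt^[j] (dt (dt H)) := by
      rw [hh, ← Function.iterate_succ_apply' (f := dt), ← Function.iterate_succ_apply' (f := dt),
        Function.iterate_succ_apply, Function.iterate_succ_apply]
    rw [e, this]
    simp only [hF, hk2, hk1, hk0, dt_iter_lap N hH, dt_iter_DD hH]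
    ring
  -- vanishing data
  have hdt : dt h = dt^[j + 1] H := (Function.iterate_succ_apply' dt j H).symm
  have v0 : ∀ k z, dt^[k] H 0 z = 0 := fun k z =>
    dt_iter_vanish hH hτ.1 (fun t ht => hH0 t ht z) k 0 ⟨le_rfl, hτ.1.le⟩
  have vb : ∀ t ∈ Icc (0:ℝ) T, dt h t 1 = 0 := by
    rw [hdt]; exact dt_iter_vanish hH hT hbd (j + 1)
  have vH : ∀ t ∈ Icc (0:ℝ) τ, H t = fun _ => 0 := fun t ht => funext (hH0 t ht)
  have vDD : ∀ t ∈ Icc (0:ℝ) τ, ∀ z, DD H t z = 0 := by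
    intro t ht z; simp [DD, dz, vH t ht]
  have vLap : ∀ t ∈ Icc (0:ℝ) τ, ∀ z, Lap N H t z = 0 := by
    intro t ht z; simp [Lap, Del, vH t ht]
  -- norms
  have hnn := fun u => QQ_nonneg N hT.le u
  have two : ∀ k n, k + 2 ≤ n → QQ N T (dt^[k] H) + QQ N T (DR (dt^[k] H)) +
      QQ N T (Lap N (dt^[k] H)) ≤ normT N T n H ^ 2 := by
    intro k n hk
    rw [← int_normN_two hN T (hH.dt_iter k)]
    exact int_le_normT N hT.le n k 2 hk H
  have dd : ∀ y, Sm y → QQ N T (DD y) ≤ QQ N T (DR y) := by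
    intro y hy
    refine QQ_mono hN hT.le hy.DD.ct hy.DR_ct fun t _ z hz => ?_
    rw [DD, DR_eq, mul_pow, mul_pow, Real.sq_sqrt hz.1]
    refine mul_le_mul_of_nonneg_right ?_ (sq_nonneg _)
    nlinarith [hz.1, hz.2]
  have c2 : QQ N T k2 ≤ C * (M ^ 2 * normT N T (j + 1) H ^ 2 + β ^ 2 * normT N T 2 H ^ 2) := by
    refine hcomm N hN b₂ (Lap N H) hb₂ (hH.lap N) τ hτ.1 vLap _ _ β M (sq_nonneg _) ?_ ?_
      (by linarith) (by linarith)
    · intro hj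
      rw [dt_iter_lap N hH]
      linarith [two (j - 1) (j + 1) (by omega), hnn (dt^[j - 1] H), hnn (DR (dt^[j - 1] H))]
    · have := two 0 2 le_rfl
      simp only [Function.iterate_zero, id] at this
      linarith [hnn H, hnn (DR H)]
  have c1 : QQ N T k1 ≤ C * (M ^ 2 * normT N T (j + 1) H ^ 2 + β ^ 2 * normT N T 2 H ^ 2) := by
    refine hcomm N hN b₁ (DD H) hb₁ hH.DD τ hτ.1 vDD _ _ β M (sq_nonneg _) ?_ ?_
      (by linarith) (by linarith)
    · intro hj
      rw [dt_iter_DD hH]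
      linarith [two (j - 1) (j + 1) (by omega), hnn (dt^[j - 1] H), hnn (Lap N (dt^[j - 1] H)),
        dd _ (hH.dt_iter (j - 1))]
    · have := two 0 2 le_rfl
      simp only [Function.iterate_zero, id] at this
      linarith [hnn H, hnn (Lap N H), dd H hH]
  have c0 : QQ N T k0 ≤ C * (M ^ 2 * normT N T (j + 1) H ^ 2 + β ^ 2 * normT N T 2 H ^ 2) := by
    refine hcomm N hN b₀ H hb₀ hH τ hτ.1 hH0 _ _ β M (sq_nonneg _) ?_ ?_
      (by linarith) (by linarith)
    · intro hj
      linarith [two (j - 1) (j + 1) (by omega), hnn (DR (dt^[j - 1] H)),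
        hnn (Lap N (dt^[j - 1] H))]
    · have := two 0 2 le_rfl
      simp only [Function.iterate_zero, id] at this
      linarith [hnn (DR H), hnn (Lap N H)]
  have hcX : C * (M ^ 2 * normT N T (j + 1) H ^ 2 + β ^ 2 * normT N T 2 H ^ 2) ≤
      C * (M ^ 2 + 1) * X ^ 2 := by
    rw [mul_assoc]
    refine mul_le_mul_of_nonneg_left ?_ hC.le
    have := mul_le_mul_of_nonneg_left xJ (sq_nonneg M)
    linarith
  have cG : QQ N T (dt^[j] G) ≤ X ^ 2 := by
    rw [← int_normN_zero]
    exact (int_le_normT N hT.le j j 0 le_rfl G).trans xG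
  have hQF : QQ N T F ≤ 4 * (1 + 3 * (C * (M ^ 2 + 1))) * X ^ 2 := by
    have := QQ_four hN hT.le (hG.dt_iter j).ct sk2.ct sk1.ct sk0.ct
    refine this.trans ?_
    linarith
  have hv : QQ N T (dt h) ≤ X ^ 2 := by
    rw [hdt, ← int_normN_zero]
    exact (int_le_normT N hT.le (j + 1) (j + 1) 0 le_rfl H).trans xJ
  have hh1 : QQ N T h + QQ N T (DR h) ≤ X ^ 2 := by
    rw [← int_normN_one hN T sh]
    exact (int_le_normT N hT.le (j + 1) j 1 le_rfl H).trans xJ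
  have : Nonempty (Icc (0:ℝ) T) := ⟨⟨0, le_rfl, hT.le⟩⟩
  refine ciSup_le fun s => ?_
  have hen := energy (b₁ := b₁) (b₀ := b₀) hN hM.le hb₂ sF.ct sh
    (fun t ht z hz => by have := (abs_le.1 (hb t ht z hz)).1; linarith)
    (fun t ht z hz => (le_supT hb₁.ct ht hz).trans
      ((le_supNT0 T 6 b₁ 0 (by norm_num)).trans (by linarith)))
    (fun t ht z hz => (le_supT hb₀.ct ht hz).trans
      ((le_supNT0 T 6 b₀ 0 (by norm_num)).trans (by linarith)))
    (fun t ht z hz => (le_supT hb₂.dt.ct ht hz).trans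
      ((le_supNT0 T 6 b₂ 1 (by norm_num)).trans (by linarith)))
    (fun t ht z hz => (le_supT hb₂.DR_ct ht hz).trans
      ((le_supNT T 6 b₂ 0 1 (by norm_num)).trans (by linarith)))
    heqj vb (v0 j) (by rw [hdt]; exact v0 (j + 1)) s.1 s.2
  have hfin : normN N 1 (h s.1) ^ 2 ≤ K * X ^ 2 := by
    refine hen.trans ?_
    have m1 : QQ N T (dt h) + QQ N T (DR h) + QQ N T h ≤ 2 * X ^ 2 := by linarith
    have m2 := mul_le_mul_of_nonneg_left m1 (show 0 ≤ 2 * M + 2 by positivity)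
    rw [hK]
    linarith
  refine (sq_le_sq₀ (Real.sqrt_nonneg _) (mul_nonneg (Real.sqrt_nonneg _) hX0)).1 ?_
  rw [mul_pow, Real.sq_sqrt hK0.le]
  exact hfin
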